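/- Let μ ∈ P be an integral weight and m ∈ ℤ_{≥1}. The map Σ_m : B(μ) → B(μ)^{⊗m}, defined as the composition of the dilation Θ_m : B(μ) → B(mμ), π ↦ mπ, the inclusion B(mμ) ⊆ B(μ)^{*m} given by subdividing a path into m pieces, and the isomorphism B(μ)^{*m} ≅ B(μ)^{⊗m} sending concatenations to tensor products, is injective and satisfies: Σ_m(π_μ) = π_μ^{⊗m}; wt(Σ_m(π)) = m·wt(π) for all π ∈ B(μ); Σ_m(ẽ_iπ) = ẽ_i^mΣ_m(π) and Σ_m(f̃_iπ) = f̃_i^mΣ_m(π) for all π ∈ B(μ) and i ∈ I (with Σ_m(0) = 0); ε_i(Σ_m(π)) = m·ε_i(π) and φ_i(Σ_m(π)) = m·φ_i(π) for all π ∈ B(μ) and i ∈ I. Moreover, for all m, n ∈ ℤ_{≥1}, Σ_n^{⊗m} ∘ Σ_m = Σ_{mn} as maps B(μ) → B(μ)^{⊗mn}. -/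

import Mathlib

open scoped Classical
noncomputable section

namespace LSPaper

/-- The clamp of a real number to the interval `[0,1]`; paths `[0,1] → V` are
encoded as functions `ℝ → V` that factor through this clamp. -/
def clamp01 (t : ℝ) : ℝ := max 0 (min 1 t)

variable {V : Type*} [AddCommGroup V] [Module ℝ V]

/-- The straight-line path `π_ν(t) = t ν` (clamped outside `[0,1]`). -/
def straight (ν : V) : ℝ → V := fun t => clamp01 t • ν

/-- The dilation `(mπ)(t) = m • π(t)`. -/
def dilate (m : ℕ) (f : ℝ → V) : ℝ → V := fun t => (m : ℝ) • f t

/-- The concatenation `π_1 * ⋯ * π_m` of a list of paths: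
`(π_1 * ⋯ * π_m)(t) = Σ_{l<k} π_l(1) + π_k(mt - k + 1)` for
`(k-1)/m ≤ t ≤ k/m`. -/
def concatList (l : List (ℝ → V)) : ℝ → V := fun t =>
  let m := l.length
  let k : ℕ := max 1 (min m (⌈(m : ℝ) * t⌉.toNat))
  (((l.take (k - 1)).map fun f => f 1).sum) +
    (l.getD (k - 1) 0) ((m : ℝ) * t - ((k : ℝ) - 1))

/-- Subdivision of a path into `m` pieces:
`π_k(t) = π(t/m + (k-1)/m) - π((k-1)/m)` (here `k` runs over `0, …, m-1`). -/
def subdiv (m : ℕ) (f : ℝ → V) : List (ℝ → V) :=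
  List.ofFn fun k : Fin m => fun t : ℝ =>
    f ((clamp01 t + (k : ℝ)) / m) - f ((k : ℝ) / m)

/-- The map `Σ_m : B(μ) → B(μ)^{⊗m}` (tensor factors encoded as a list):
dilate by `m`, then subdivide into `m` pieces. -/
def SigmaMap (m : ℕ) (f : ℝ → V) : List (ℝ → V) := subdiv m (dilate m f)

/-- The weight of a tensor product (encoded as a list of paths): the sum of
the weights of the factors. -/
def tensWt (l : List (ℝ → V)) : V := (l.map fun f => f 1).sum

/-- A symmetrizable generalized Cartan matrix together with a realization:
an integral weight lattice `P` inside a real vector space `V`, linearly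
independent simple roots `α i ∈ P` and simple coroots (as linear functionals)
with `⟨α j, α i∨⟩ = a i j`, taking integer values on `P`. -/
structure KacMoodyData (I : Type*) (V : Type*) [Fintype I] [DecidableEq I]
    [AddCommGroup V] [Module ℝ V] where
  a : I → I → ℤ
  d : I → ℤ
  P : AddSubgroup V
  α : I → V
  coroot : I → V →ₗ[ℝ] ℝ
  diag : ∀ i, a i i = 2
  offDiag : ∀ i j, i ≠ j → a i j ≤ 0
  zeroIff : ∀ i j, a i j = 0 ↔ a j i = 0
  dPos : ∀ i, 0 < d i
  symmetrizable : ∀ i j, d i * a i j = d j * a j i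
  cartanPairing : ∀ i j, coroot i (α j) = (a i j : ℝ)
  rootsIndep : LinearIndependent ℝ α
  corootsIndep : LinearIndependent ℝ coroot
  rootMem : ∀ i, α i ∈ P
  pairingInt : ∀ i, ∀ v ∈ P, ∃ n : ℤ, coroot i v = (n : ℝ)
  latticeFree : ∃ n : ℕ, Nonempty (P ≃+ (Fin n → ℤ))

namespace KacMoodyData

variable {I : Type*} [Fintype I] [DecidableEq I]
variable (K : KacMoodyData I V)

/-- The simple reflection `r_i(x) = x - ⟨x, α_i∨⟩ α_i` as a linear map. -/
def reflMap (i : I) : V →ₗ[ℝ] V := LinearMap.id - (K.coroot i).smulRight (K.α i)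

lemma reflMap_invol (i : I) : Function.Involutive (K.reflMap i) := by
  intro x
  have h2 : K.coroot i (K.α i) = 2 := by
    have h := K.cartanPairing i i
    rw [K.diag i] at h
    simpa using h
  simp only [reflMap, LinearMap.sub_apply, LinearMap.id_apply, LinearMap.smulRight_apply,
    map_sub, map_smul, smul_eq_mul, h2]
  module

/-- The simple reflection `r_i` as a linear automorphism of `V`. -/
def refl (i : I) : V ≃ₗ[ℝ] V :=
  { K.reflMap i with
    invFun := K.reflMap i
    left_inv := K.reflMap_invol i
    right_inv := K.reflMap_invol i }

/-- The Weyl group `W`, generated by the simple reflections. -/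
def weylGroup : Subgroup (V ≃ₗ[ℝ] V) := Subgroup.closure (Set.range K.refl)

/-- The Weyl group orbit `W μ` of an integral weight. -/
def orbit (μ : V) : Set V := {ν | ∃ w ∈ K.weylGroup, ν = w μ}

/-- `Q_+ = Σ_i ℤ_{≥0} α_i`. -/
def Qplus : Set V := {v | ∃ c : I → ℕ, v = ∑ i, (c i : ℝ) • K.α i}

/-- One step of the order on a Weyl group orbit:  `ν' = r_β(ν)` for a positive
real root `β = w α_i ∈ Q_+` (with `β∨ = w α_i∨`, `r_β = w r_i w⁻¹`) such that
`⟨ν, β∨⟩ < 0`. -/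
def StepDown (ν ν' : V) : Prop :=
  ∃ w ∈ K.weylGroup, ∃ i : I, w (K.α i) ∈ K.Qplus ∧
    K.coroot i (w.symm ν) < 0 ∧ ν' = w (K.refl i (w.symm ν))

/-- There is a chain `ν = ξ_0, ξ_1, …, ξ_p = ν'` of steps down. -/
def chainLen (p : ℕ) (ν ν' : V) : Prop :=
  ∃ ξ : ℕ → V, ξ 0 = ν ∧ ξ p = ν' ∧ ∀ q < p, K.StepDown (ξ q) (ξ (q + 1))

/-- `dist(ν, ν')`: the maximal length of a chain from `ν` down to `ν'`. -/
def dist (ν ν' : V) : ℕ := sSup {p | K.chainLen p ν ν'}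

/-- A `σ`-chain for `(ν, ν')`: a sequence `ν = ξ_0 > ξ_1 > ⋯ > ξ_p = ν'` with
`dist(ξ_{q-1}, ξ_q) = 1` and `σ ⟨ξ_{q-1}, β_q∨⟩ ∈ ℤ_{<0}`, where `β_q` is the
positive real root with `ξ_q = r_{β_q} ξ_{q-1}`. -/
def SigmaChain (σ : ℚ) (ν ν' : V) : Prop :=
  ∃ p : ℕ, 0 < p ∧ ∃ ξ : ℕ → V, ξ 0 = ν ∧ ξ p = ν' ∧
    ∀ q < p, K.dist (ξ q) (ξ (q + 1)) = 1 ∧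
      ∃ w ∈ K.weylGroup, ∃ i : I, w (K.α i) ∈ K.Qplus ∧
        ξ (q + 1) = w (K.refl i (w.symm (ξ q))) ∧
        ∃ n : ℤ, n < 0 ∧ (σ : ℝ) * K.coroot i (w.symm (ξ q)) = (n : ℝ)

/-- The combinatorial datum of a Lakshmibai–Seshadri path of shape `μ`:
a strictly decreasing sequence `ν_1 > ν_2 > ⋯ > ν_s` in `W μ` together with
rationals `0 = σ_0 < σ_1 < ⋯ < σ_s = 1` admitting `σ_u`-chains (the `ν`'s are
indexed here by `Fin s`, i.e. `0, …, s-1`). -/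
structure LSData (K : KacMoodyData I V) (μ : V) where
  s : ℕ
  spos : 0 < s
  ν : Fin s → V
  τ : Fin (s + 1) → ℚ
  mem : ∀ u, ν u ∈ K.orbit μ
  strictDec : ∀ (u : ℕ) (h : u + 1 < s),
    Relation.TransGen K.StepDown (ν ⟨u, Nat.lt_of_succ_lt h⟩) (ν ⟨u + 1, h⟩)
  τ_zero : τ 0 = 0
  τ_last : τ (Fin.last s) = 1
  τ_mono : StrictMono τ
  chainCond : ∀ (u : ℕ) (h : u + 1 < s),
    K.SigmaChain (τ ⟨u + 1, Nat.lt_succ_of_lt h⟩) (ν ⟨u, Nat.lt_of_succ_lt h⟩) (ν ⟨u + 1, h⟩)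

/-- The piecewise-linear path `[0,1] → ℝ ⊗ P` associated with an LS datum:
`π(t) = Σ_{k<u} (σ_k - σ_{k-1}) ν_k + (t - σ_{u-1}) ν_u` for `σ_{u-1} ≤ t ≤ σ_u`,
encoded as the function `ℝ → V`, `t ↦ Σ_k (min t σ_{k+1} - min t σ_k) • ν_k`
(which is constant for `t ≤ 0` and `t ≥ 1`). -/
def LSData.path {K : KacMoodyData I V} {μ : V} (π : K.LSData μ) : ℝ → V := fun t =>
  ∑ k : Fin π.s,
    ((min t ((π.τ k.succ : ℚ) : ℝ)) - (min t ((π.τ k.castSucc : ℚ) : ℝ))) • π.ν k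

/-- `B(μ)`: the set of Lakshmibai–Seshadri paths of shape `μ`. -/
def B (μ : V) : Set (ℝ → V) := {f | ∃ π : K.LSData μ, f = π.path}

/-- `H_i^π(t) = ⟨π(t), α_i∨⟩`. -/
def H (i : I) (f : ℝ → V) : ℝ → ℝ := fun t => K.coroot i (f t)

/-- `m_i^π = min {H_i^π(t) : t ∈ [0,1]}`. -/
def mval (i : I) (f : ℝ → V) : ℝ := sInf (K.H i f '' Set.Icc 0 1)

/-- The raising root operator `ẽ_i` (the underlying path, before testing
whether it is defined): with `t_1 = min {t : H_i^π(t) = m_i^π}` and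
`t_0 = max {t ≤ t_1 : H_i^π(t) = m_i^π + 1}`, the new path is `π(t)` for
`t ≤ t_0`, `r_i(π(t) - π(t_0)) + π(t_0)` for `t_0 ≤ t ≤ t_1` and `π(t) + α_i`
for `t ≥ t_1`. -/
def eraw (i : I) (f : ℝ → V) : ℝ → V := fun t =>
  let m := K.mval i f
  let t1 := sInf {t | t ∈ Set.Icc (0 : ℝ) 1 ∧ K.H i f t = m}
  let t0 := sSup {t | t ∈ Set.Icc (0 : ℝ) t1 ∧ K.H i f t = m + 1}
  if t ≤ t0 then f t
  else if t ≤ t1 then K.refl i (f t - f t0) + f t0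
  else f t + K.α i

/-- The lowering root operator `f̃_i` (the underlying path): with
`t_0 = max {t : H_i^π(t) = m_i^π}` and `t_1 = min {t ≥ t_0 : H_i^π(t) = m_i^π + 1}`,
the new path is `π(t)` for `t ≤ t_0`, `r_i(π(t) - π(t_0)) + π(t_0)` for
`t_0 ≤ t ≤ t_1` and `π(t) - α_i` for `t ≥ t_1`. -/
def fraw (i : I) (f : ℝ → V) : ℝ → V := fun t =>
  let m := K.mval i f
  let t0 := sSup {t | t ∈ Set.Icc (0 : ℝ) 1 ∧ K.H i f t = m}
  let t1 := sInf {t | t ∈ Set.Icc t0 1 ∧ K.H i f t = m + 1}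
  if t ≤ t0 then f t
  else if t ≤ t1 then K.refl i (f t - f t0) + f t0
  else f t - K.α i

/-- The root operator `ẽ_i`, with value `none` (the formal element `0`) when
`m_i^π = 0`. -/
def eop (i : I) (f : ℝ → V) : Option (ℝ → V) :=
  if K.mval i f = 0 then none else some (K.eraw i f)

/-- The root operator `f̃_i`, with value `none` (the formal element `0`) when
`H_i^π(1) - m_i^π = 0`. -/
def fop (i : I) (f : ℝ → V) : Option (ℝ → V) :=
  if K.H i f 1 - K.mval i f = 0 then none else some (K.fraw i f)

/-- `ẽ_i^n π` (with `ẽ_i 0 = 0`). -/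
def eIter (i : I) (n : ℕ) (f : ℝ → V) : Option (ℝ → V) :=
  (fun o => o.bind (K.eop i))^[n] (some f)

/-- `f̃_i^n π` (with `f̃_i 0 = 0`). -/
def fIter (i : I) (n : ℕ) (f : ℝ → V) : Option (ℝ → V) :=
  (fun o => o.bind (K.fop i))^[n] (some f)

/-- `ε_i(π) = max {n ≥ 0 : ẽ_i^n π ≠ 0}`. -/
def epsilon (i : I) (f : ℝ → V) : ℕ := sSup {n | K.eIter i n f ≠ none}

/-- `φ_i(π) = max {n ≥ 0 : f̃_i^n π ≠ 0}`. -/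
def phi (i : I) (f : ℝ → V) : ℕ := sSup {n | K.fIter i n f ≠ none}

/-- The Weyl group action on a normal crystal:
`S_i b = f̃_i^{⟨wt b, α_i∨⟩} b` if `⟨wt b, α_i∨⟩ ≥ 0` and
`S_i b = ẽ_i^{-⟨wt b, α_i∨⟩} b` if `⟨wt b, α_i∨⟩ ≤ 0`. -/
def Sop (i : I) (f : ℝ → V) : Option (ℝ → V) :=
  if 0 ≤ K.coroot i (f 1) then K.fIter i (⌊K.coroot i (f 1)⌋.toNat) f
  else K.eIter i ((-⌊K.coroot i (f 1)⌋).toNat) f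

/-- `SWord K [i₁, …, i_k] b = S_{i₁} S_{i₂} ⋯ S_{i_k} b`. -/
def SWord (K : KacMoodyData I V) : List I → Option (ℝ → V) → Option (ℝ → V)
  | [], o => o
  | i :: rest, o => (SWord K rest o).bind (K.Sop i)

/-- `b` is extremal: for each `w ∈ W` (as a word in simple reflections) and
`i ∈ I`, `ẽ_i (S_w b) = 0` if `⟨wt (S_w b), α_i∨⟩ ≥ 0` and `f̃_i (S_w b) = 0`
if `⟨wt (S_w b), α_i∨⟩ ≤ 0`. -/
def Extremal (f : ℝ → V) : Prop :=
  ∀ (l : List I) (g : ℝ → V), K.SWord l (some f) = some g →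
    ∀ i : I, (0 ≤ K.coroot i (g 1) → K.eop i g = none) ∧
      (K.coroot i (g 1) ≤ 0 → K.fop i g = none)

/-- Application of a word in the Kashiwara operators (`true` stands for `ẽ`,
`false` for `f̃`), leftmost entry applied first. -/
def applyWord (K : KacMoodyData I V) :
    List (I × Bool) → Option (ℝ → V) → Option (ℝ → V)
  | [], o => o
  | p :: rest, o =>
      applyWord K rest (o.bind fun f => if p.2 then K.eop p.1 f else K.fop p.1 f)

/-- `B(μ)^{*m}`: the set of `m`-fold concatenations of LS paths of shape `μ`. -/
def ConcatSet (μ : V) (m : ℕ) : Set (ℝ → V) :=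
  {g | ∃ l : List (ℝ → V), l.length = m ∧ (∀ f ∈ l, f ∈ K.B μ) ∧ g = concatList l}

/-- `ε_i` of a tensor product (encoded as a list of paths, Kashiwara's rule):
`ε_i(b₁ ⊗ b₂) = max (ε_i b₁) (ε_i b₂ - ⟨wt b₁, α_i∨⟩)`. -/
def tensEps (K : KacMoodyData I V) (i : I) : List (ℝ → V) → ℤ
  | [] => 0
  | [b] => (K.epsilon i b : ℤ)
  | b :: c :: rest =>
      max ((K.epsilon i b : ℤ)) (tensEps K i (c :: rest) - ⌊K.coroot i (b 1)⌋)

/-- `φ_i` of a tensor product (Kashiwara's rule):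
`φ_i(b₁ ⊗ b₂) = max (φ_i b₂) (φ_i b₁ + ⟨wt b₂, α_i∨⟩)`. -/
def tensPhi (K : KacMoodyData I V) (i : I) : List (ℝ → V) → ℤ
  | [] => 0
  | [b] => (K.phi i b : ℤ)
  | b :: c :: rest =>
      max (tensPhi K i (c :: rest)) ((K.phi i b : ℤ) + ⌊K.coroot i (tensWt (c :: rest))⌋)

/-- `ẽ_i` on a tensor product (Kashiwara's rule):
`ẽ_i(b₁ ⊗ b₂) = (ẽ_i b₁) ⊗ b₂` if `φ_i(b₁) ≥ ε_i(b₂)`, else `b₁ ⊗ (ẽ_i b₂)`. -/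
def tensE (K : KacMoodyData I V) (i : I) : List (ℝ → V) → Option (List (ℝ → V))
  | [] => none
  | [b] => (K.eop i b).map fun b' => [b']
  | b :: c :: rest =>
      if K.tensEps i (c :: rest) ≤ (K.phi i b : ℤ) then
        (K.eop i b).map fun b' => b' :: c :: rest
      else (tensE K i (c :: rest)).map fun r' => b :: r'

/-- `f̃_i` on a tensor product (Kashiwara's rule):
`f̃_i(b₁ ⊗ b₂) = (f̃_i b₁) ⊗ b₂` if `φ_i(b₁) > ε_i(b₂)`, else `b₁ ⊗ (f̃_i b₂)`. -/
def tensF (K : KacMoodyData I V) (i : I) : List (ℝ → V) → Option (List (ℝ → V))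
  | [] => none
  | [b] => (K.fop i b).map fun b' => [b']
  | b :: c :: rest =>
      if K.tensEps i (c :: rest) < (K.phi i b : ℤ) then
        (K.fop i b).map fun b' => b' :: c :: rest
      else (tensF K i (c :: rest)).map fun r' => b :: r'

/-- `ẽ_i^n` on tensor products. -/
def tensEIter (i : I) (n : ℕ) (l : List (ℝ → V)) : Option (List (ℝ → V)) :=
  (fun o => o.bind (K.tensE i))^[n] (some l)

/-- `f̃_i^n` on tensor products. -/
def tensFIter (i : I) (n : ℕ) (l : List (ℝ → V)) : Option (List (ℝ → V)) :=
  (fun o => o.bind (K.tensF i))^[n] (some l)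

end KacMoodyData

end LSPaper

namespace LSPaper

lemma clamp01_of_mem {t : ℝ} (h0 : 0 ≤ t) (h1 : t ≤ 1) : clamp01 t = t := by
  simp [clamp01, h0, h1]

lemma clamp01_of_nonpos {t : ℝ} (h0 : t ≤ 0) : clamp01 t = 0 := by
  have : min 1 t ≤ 0 := (min_le_right _ _).trans h0
  simp [clamp01, this]

lemma clamp01_of_one_le {t : ℝ} (h1 : 1 ≤ t) : clamp01 t = 1 := by
  simp [clamp01, h1]

lemma clamp01_nonneg (t : ℝ) : 0 ≤ clamp01 t := le_max_left _ _

lemma clamp01_le_one (t : ℝ) : clamp01 t ≤ 1 := by simp [clamp01]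

lemma continuous_clamp01 : Continuous clamp01 := by
  unfold clamp01; fun_prop

lemma clamp01_one_sub (t : ℝ) : clamp01 (1 - t) = 1 - clamp01 t := by
  rcases le_total t 0 with h | h
  · rw [clamp01_of_nonpos h, clamp01_of_one_le (by linarith)]; simp
  rcases le_total t 1 with h' | h'
  · rw [clamp01_of_mem h h', clamp01_of_mem] <;> linarith
  · rw [clamp01_of_one_le h', clamp01_of_nonpos (by linarith)]; simp

/-- The real number `x` is an integer. -/
def IsInt (x : ℝ) : Prop := ∃ n : ℤ, x = n

namespace IsInt

lemma intCast (n : ℤ) : IsInt (n : ℝ) := ⟨n, rfl⟩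

lemma natCast (n : ℕ) : IsInt (n : ℝ) := ⟨n, by simp⟩

lemma zero : IsInt 0 := ⟨0, by simp⟩

lemma one : IsInt 1 := ⟨1, by simp⟩

lemma add {x y : ℝ} : IsInt x → IsInt y → IsInt (x + y) := by
  rintro ⟨n, rfl⟩ ⟨k, rfl⟩; exact ⟨n + k, by push_cast; rfl⟩

lemma sub {x y : ℝ} : IsInt x → IsInt y → IsInt (x - y) := by
  rintro ⟨n, rfl⟩ ⟨k, rfl⟩; exact ⟨n - k, by push_cast; rfl⟩

lemma mul {x y : ℝ} : IsInt x → IsInt y → IsInt (x * y) := by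
  rintro ⟨n, rfl⟩ ⟨k, rfl⟩; exact ⟨n * k, by push_cast; rfl⟩

lemma neg {x : ℝ} : IsInt x → IsInt (-x) := by
  rintro ⟨n, rfl⟩; exact ⟨-n, by push_cast; rfl⟩

lemma max {x y : ℝ} (hx : IsInt x) (hy : IsInt y) : IsInt (max x y) := by
  rcases max_choice x y with h | h <;> rwa [h]

lemma add_one_le {x y : ℝ} : IsInt x → IsInt y → x < y → x + 1 ≤ y := by
  rintro ⟨n, rfl⟩ ⟨k, rfl⟩ h
  exact_mod_cast h

lemma cast_floor {x : ℝ} : IsInt x → ((⌊x⌋ : ℤ) : ℝ) = x := by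
  rintro ⟨n, rfl⟩; simp

end IsInt

/-- The minimum of `h` on `[a, b]`. -/
def runMin (h : ℝ → ℝ) (a b : ℝ) : ℝ := sInf (h '' Set.Icc a b)

section runMin

variable {h : ℝ → ℝ} {a b c t : ℝ}

lemma runMin_le (hc : Continuous h) (ha : a ≤ t) (hb : t ≤ b) : runMin h a b ≤ h t :=
  csInf_le (isCompact_Icc.image hc).bddBelow ⟨t, ⟨ha, hb⟩, rfl⟩

lemma exists_eq_runMin (hc : Continuous h) (hab : a ≤ b) :
    ∃ t, a ≤ t ∧ t ≤ b ∧ h t = runMin h a b := by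
  obtain ⟨t, ht, e⟩ := (isCompact_Icc.image hc).sInf_mem
    ((Set.nonempty_Icc.2 hab).image h)
  exact ⟨t, ht.1, ht.2, e⟩

lemma le_runMin (hab : a ≤ b) (H : ∀ t, a ≤ t → t ≤ b → c ≤ h t) : c ≤ runMin h a b := by
  refine le_csInf ((Set.nonempty_Icc.2 hab).image h) ?_
  rintro _ ⟨t, ht, rfl⟩
  exact H t ht.1 ht.2

lemma runMin_congr {h' : ℝ → ℝ} (H : ∀ t, a ≤ t → t ≤ b → h t = h' t) :
    runMin h a b = runMin h' a b := by
  unfold runMin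
  congr 1
  exact Set.image_congr fun t ht => H t ht.1 ht.2

lemma runMin_self : runMin h a a = h a := by simp [runMin]

lemma runMin_anti_right (hc : Continuous h) (hab : a ≤ b) (hbc : b ≤ c) :
    runMin h a c ≤ runMin h a b :=
  le_runMin hab fun _ h1 h2 => runMin_le hc h1 (h2.trans hbc)

lemma runMin_mono_left (hc : Continuous h) (hab : a ≤ b) (hbc : b ≤ c) :
    runMin h a c ≤ runMin h b c :=
  le_runMin hbc fun _ h1 h2 => runMin_le hc (hab.trans h1) h2

lemma runMin_split (hc : Continuous h) (hab : a ≤ b) (hbc : b ≤ c) :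
    runMin h a c = min (runMin h a b) (runMin h b c) := by
  refine le_antisymm (le_min (runMin_anti_right hc hab hbc) (runMin_mono_left hc hab hbc)) ?_
  refine le_runMin (hab.trans hbc) fun t h1 h2 => ?_
  rcases le_total t b with h' | h'
  · exact (min_le_left _ _).trans (runMin_le hc h1 h')
  · exact (min_le_right _ _).trans (runMin_le hc h' h2)

lemma runMin_sub_const (hc : Continuous h) (hab : a ≤ b) (c : ℝ) :
    runMin (fun t => h t - c) a b = runMin h a b - c := by
  obtain ⟨t, h1, h2, e⟩ := exists_eq_runMin hc hab
  refine le_antisymm ?_ (le_runMin hab fun t h1 h2 => by linarith [runMin_le hc h1 h2])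
  rw [← e]
  exact runMin_le (h := fun t => h t - c) (by fun_prop) h1 h2

lemma runMin_const_mul (hc : Continuous h) (hab : a ≤ b) (hc0 : 0 ≤ c) :
    runMin (fun t => c * h t) a b = c * runMin h a b := by
  obtain ⟨t, h1, h2, e⟩ := exists_eq_runMin hc hab
  refine le_antisymm ?_ (le_runMin hab fun t h1 h2 =>
    mul_le_mul_of_nonneg_left (runMin_le hc h1 h2) hc0)
  rw [← e]
  exact runMin_le (h := fun t => c * h t) (by fun_prop) h1 h2

lemma runMin_one_sub (h : ℝ → ℝ) (a b : ℝ) :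
    runMin (fun t => h (1 - t)) a b = runMin h (1 - b) (1 - a) := by
  unfold runMin
  rw [← Set.image_image (g := h) (f := fun t => 1 - t), Set.image_const_sub_Icc]

lemma continuous_runMin_left (hc : Continuous h) :
    Continuous fun t => runMin h 0 (clamp01 t) := by
  have key : ∀ t, runMin h 0 (clamp01 t) =
      sInf ((fun s => h (s * clamp01 t)) '' Set.Icc (0 : ℝ) 1) := by
    intro t
    have hr : (fun s => s * clamp01 t) '' Set.Icc (0 : ℝ) 1 = Set.Icc 0 (clamp01 t) := by
      rw [Set.image_mul_right_Icc zero_le_one (clamp01_nonneg t)]; simp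
    rw [runMin, ← hr, Set.image_image]
  simp only [key]
  refine isCompact_Icc.continuous_sInf (f := fun t s => h (s * clamp01 t)) ?_
  have := continuous_clamp01
  simp only [Function.HasUncurry.uncurry, id]
  fun_prop

end runMin

/-- Minima of `h` over subintervals of `[0, 1]` are integers or attained at an end point. -/
def IntMin (h : ℝ → ℝ) : Prop :=
  ∀ a b, 0 ≤ a → a ≤ b → b ≤ 1 →
    IsInt (runMin h a b) ∨ runMin h a b = h a ∨ runMin h a b = h b

/-- The Pitman transform of `h` at level `x`. -/
def pitman (x : ℝ) (h : ℝ → ℝ) : ℝ → ℝ := fun t =>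
  h t + 2 * max 0 (x - runMin h 0 (clamp01 t))

/-- The Pitman transform of `h` at level `x`, started from the right end point. -/
def pitmanR (x : ℝ) (h : ℝ → ℝ) : ℝ → ℝ := fun t =>
  h t + 2 * max 0 (x - runMin h (clamp01 t) 1)

section pitman

variable {h : ℝ → ℝ} {x : ℝ}

lemma pitman_continuous (hc : Continuous h) (x : ℝ) : Continuous (pitman x h) := by
  have := continuous_runMin_left hc
  unfold pitman
  fun_prop

lemma pitman_apply {t : ℝ} (h0 : 0 ≤ t) (h1 : t ≤ 1) :
    pitman x h t = h t + 2 * max 0 (x - runMin h 0 t) := by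
  rw [pitman, clamp01_of_mem h0 h1]

lemma exists_first_level (hc : Continuous h) {a b y : ℝ} (hab : a ≤ b) (ha : y ≤ h a)
    (hb : runMin h a b ≤ y) : ∃ e, a ≤ e ∧ e ≤ b ∧ h e = y ∧ runMin h a e = y := by
  obtain ⟨u, hu1, hu2, hu⟩ := exists_eq_runMin hc hab
  set S := {t | t ∈ Set.Icc a b ∧ h t = y}
  have hS : IsCompact S := isCompact_Icc.inter_right (isClosed_eq hc continuous_const)
  have hne : S.Nonempty := by
    obtain ⟨e, he, hey⟩ := intermediate_value_Icc' hu1 hc.continuousOn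
      (show y ∈ Set.Icc (h u) (h a) from ⟨by linarith, ha⟩)
    exact ⟨e, ⟨he.1, he.2.trans hu2⟩, hey⟩
  obtain ⟨e, ⟨he, hey⟩, hmin⟩ := hS.exists_isLeast hne
  refine ⟨e, he.1, he.2, hey, le_antisymm (hey ▸ runMin_le hc he.1 le_rfl) ?_⟩
  refine le_runMin he.1 fun t h1 h2 => ?_
  by_contra! hlt
  obtain ⟨s, hs, hsy⟩ := intermediate_value_Icc' h1 hc.continuousOn
    (show y ∈ Set.Icc (h t) (h a) from ⟨hlt.le, ha⟩)
  have : e ≤ s := hmin ⟨⟨hs.1, hs.2.trans (h2.trans he.2)⟩, hsy⟩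
  have : t = e := by linarith [hs.2]
  rw [this] at hlt
  linarith

lemma le_pitman (hc : Continuous h) {t : ℝ} (h0 : 0 ≤ t) (h1 : t ≤ 1) :
    max (runMin h 0 t) x ≤ pitman x h t := by
  rw [pitman_apply h0 h1]
  have := runMin_le hc h0 le_rfl
  refine max_le ?_ ?_
  · linarith [le_max_left 0 (x - runMin h 0 t)]
  · linarith [le_max_left 0 (x - runMin h 0 t), le_max_right 0 (x - runMin h 0 t)]

lemma runMin_pitman (hc : Continuous h) (hx : x ≤ h 0) {t : ℝ} (h0 : 0 ≤ t) (h1 : t ≤ 1) :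
    runMin (pitman x h) 0 t = max (runMin h 0 t) x := by
  have hc' := pitman_continuous hc x
  refine le_antisymm ?_ (le_runMin h0 fun s hs0 hs1 =>
    (max_le_max_right x (runMin_anti_right hc hs0 hs1)).trans
      (le_pitman hc hs0 (hs1.trans h1)))
  have hm : runMin h 0 t ≤ max (runMin h 0 t) x := le_max_left _ _
  have hy : max (runMin h 0 t) x ≤ h 0 := max_le (runMin_le hc le_rfl h0) hx
  obtain ⟨e, he0, he1, hey, hem⟩ := exists_first_level hc h0 hy hm
  refine (runMin_le hc' he0 he1).trans ?_
  rw [pitman_apply he0 (he1.trans h1), hem, hey]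
  simp

lemma pitman_intMin (hc : Continuous h) (hxi : IsInt x) (h0i : IsInt (h 0))
    (H : IntMin h) : IntMin (pitman x h) := by
  have hc' := pitman_continuous hc x
  intro a b ha hab hb
  have hIanti := runMin_anti_right hc ha hab
  rcases le_or_gt x (runMin h 0 b) with hxb | hxb
  · have e : ∀ t, a ≤ t → t ≤ b → pitman x h t = h t := by
      intro t h1 h2
      rw [pitman_apply (ha.trans h1) (h2.trans hb), max_eq_left]
      · simp
      · linarith [runMin_anti_right hc (ha.trans h1) h2]
    rw [runMin_congr e, e a le_rfl hab, e b hab le_rfl]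
    exact H a b ha hab hb
  rcases le_or_gt x (runMin h 0 a) with hxa | hxa
  · left
    have hxa' : x ≤ h a := hxa.trans (runMin_le hc ha le_rfl)
    have hmb : runMin h a b ≤ x := by
      rw [runMin_split hc ha hab, min_lt_iff] at hxb
      rcases hxb with h' | h' <;> linarith
    obtain ⟨e, he0, he1, hey, hem⟩ := exists_first_level hc hab hxa' hmb
    have hv : pitman x h e = x := by
      rw [pitman_apply (ha.trans he0) (he1.trans hb), runMin_split hc ha he0, hem,
        min_eq_right hxa, hey]
      simp
    have : runMin (pitman x h) a b = x := by
      refine le_antisymm ((runMin_le hc' he0 he1).trans hv.le) (le_runMin hab fun t h1 h2 => ?_)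
      exact (le_max_right _ _).trans (le_pitman hc (ha.trans h1) (h2.trans hb))
    rwa [this]
  · have e : ∀ t, a ≤ t → t ≤ b → pitman x h t = h t + 2 * (x - runMin h 0 t) := by
      intro t h1 h2
      rw [pitman_apply (ha.trans h1) (h2.trans hb), max_eq_right]
      linarith [runMin_anti_right hc ha h1]
    have hDa : IsInt (runMin h 0 a) ∨ runMin h 0 a = h a := by
      rcases H 0 a le_rfl ha (hab.trans hb) with h' | h' | h'
      · exact Or.inl h'
      · exact Or.inl (h' ▸ h0i)
      · exact Or.inr h'
    rcases hIanti.eq_or_lt with heq | hlt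
    · have e' : ∀ t, a ≤ t → t ≤ b →
          pitman x h t = h t - (-(2 * (x - runMin h 0 a))) := by
        intro t h1 h2
        have := runMin_anti_right hc ha h1
        have := runMin_anti_right hc (ha.trans h1) h2
        rw [e t h1 h2, show runMin h 0 t = runMin h 0 a by linarith]
        ring
      rw [runMin_congr e', runMin_sub_const hc hab, e' a le_rfl hab, e' b hab le_rfl]
      rcases hDa with hi | hi
      · rcases H a b ha hab hb with h' | h' | h'
        · refine Or.inl (h'.sub ((IsInt.mul ⟨2, by simp⟩ (hxi.sub hi)).neg))
        · exact Or.inr (Or.inl (by rw [h']))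
        · exact Or.inr (Or.inr (by rw [h']))
      · right; left
        have : runMin h a b = h a := by
          refine le_antisymm (runMin_le hc le_rfl hab) ?_
          rw [← hi, ← heq]
          exact runMin_mono_left hc ha hab
        rw [this]
    · have hmb : runMin h a b ≤ runMin h 0 a := by
        rw [runMin_split hc ha hab, min_lt_iff] at hlt
        rcases hlt with h' | h' <;> linarith
      obtain ⟨u, hu0, hu1, huy, hum⟩ :=
        exists_first_level hc hab (runMin_le hc ha le_rfl) hmb
      have hv : pitman x h u = 2 * x - runMin h 0 a := by
        rw [e u hu0 hu1, runMin_split hc ha hu0, hum, huy]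
        simp; ring
      have hm : runMin (pitman x h) a b = 2 * x - runMin h 0 a := by
        refine le_antisymm ((runMin_le hc' hu0 hu1).trans hv.le) (le_runMin hab fun t h1 h2 => ?_)
        rw [e t h1 h2]
        linarith [runMin_anti_right hc ha h1, runMin_le hc (ha.trans h1) le_rfl]
      rw [hm]
      rcases hDa with hi | hi
      · exact Or.inl ((IsInt.mul ⟨2, by simp⟩ hxi).sub hi)
      · right; left
        rw [e a le_rfl hab, hi]; ring

lemma IntMin.one_sub (H : IntMin h) : IntMin fun t => h (1 - t) := by
  intro a b ha hab hb
  rw [runMin_one_sub]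
  rcases H (1 - b) (1 - a) (by linarith) (by linarith) (by linarith) with h' | h' | h'
  · exact Or.inl h'
  · exact Or.inr (Or.inr h')
  · exact Or.inr (Or.inl h')

lemma IntMin.sub_const (hc : Continuous h) (H : IntMin h) {c : ℝ} (hi : IsInt c) :
    IntMin fun t => h t - c := by
  intro a b ha hab hb
  rw [runMin_sub_const hc hab]
  rcases H a b ha hab hb with h' | h' | h'
  · exact Or.inl (h'.sub hi)
  · exact Or.inr (Or.inl (by rw [h']))
  · exact Or.inr (Or.inr (by rw [h']))

lemma IntMin.const_mul (hc : Continuous h) (H : IntMin h) (n : ℕ) :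
    IntMin fun t => (n : ℝ) * h t := by
  intro a b ha hab hb
  rw [runMin_const_mul hc hab n.cast_nonneg]
  rcases H a b ha hab hb with h' | h' | h'
  · exact Or.inl ((IsInt.natCast n).mul h')
  · exact Or.inr (Or.inl (by rw [h']))
  · exact Or.inr (Or.inr (by rw [h']))

lemma pitmanR_eq (x : ℝ) (h : ℝ → ℝ) :
    pitmanR x h = fun t => pitman x (fun s => h (1 - s)) (1 - t) := by
  ext t
  simp only [pitmanR, pitman]
  rw [runMin_one_sub, clamp01_one_sub]
  simp

lemma pitmanR_continuous (hc : Continuous h) (x : ℝ) : Continuous (pitmanR x h) := by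
  rw [pitmanR_eq]
  have := pitman_continuous (h := fun s => h (1 - s)) (by fun_prop) x
  fun_prop

lemma runMin_pitmanR (hc : Continuous h) (hx : x ≤ h 1) {t : ℝ} (h0 : 0 ≤ t) (h1 : t ≤ 1) :
    runMin (pitmanR x h) t 1 = max (runMin h t 1) x := by
  rw [pitmanR_eq, runMin_one_sub, sub_self, runMin_pitman (by fun_prop) (by simpa using hx)
    (by linarith) (by linarith), runMin_one_sub]
  simp

lemma pitmanR_intMin (hc : Continuous h) (hxi : IsInt x) (h1i : IsInt (h 1))
    (H : IntMin h) : IntMin (pitmanR x h) := by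
  rw [pitmanR_eq]
  exact (pitman_intMin (by fun_prop) hxi (by simpa using h1i)
    H.one_sub).one_sub

end pitman

namespace KacMoodyData

variable {I V : Type*} [Fintype I] [DecidableEq I] [AddCommGroup V] [Module ℝ V]

section

variable (K : KacMoodyData I V) (i : I)

/-- A path whose `i`-th height function is continuous, has integral local minima and takes
integral values at the multiples of `1 / m`. -/
structure IntegralPath (m : ℕ) (f : ℝ → V) : Prop where
  cont : Continuous (K.H i f)
  zero : f 0 = 0
  clamp : ∀ t, f t = f (clamp01 t)
  intMin : IntMin (K.H i f)
  int : ∀ k ≤ m, IsInt (K.H i f ((k : ℝ) / m))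

/-- Raising `f` to the level `x`: an iterate of `ẽ_i` in closed form. -/
def raiseTo (x : ℝ) (f : ℝ → V) : ℝ → V := fun t =>
  f t + max 0 (x - runMin (K.H i f) 0 (clamp01 t)) • K.α i

/-- Lowering `f` through the level `x`: an iterate of `f̃_i` in closed form. -/
def lowerTo (x : ℝ) (f : ℝ → V) : ℝ → V := fun t =>
  f t + (max 0 (x - runMin (K.H i f) (clamp01 t) 1) -
    max 0 (x - runMin (K.H i f) 0 1)) • K.α i

lemma coroot_α_self : K.coroot i (K.α i) = 2 := by
  rw [K.cartanPairing, K.diag]; norm_num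

lemma refl_apply (v : V) : K.refl i v = v - K.coroot i v • K.α i := rfl

lemma refl_refl (v : V) : K.refl i (K.refl i v) = v := K.reflMap_invol i v

lemma coroot_refl (v : V) : K.coroot i (K.refl i v) = -K.coroot i v := by
  rw [refl_apply, map_sub, map_smul, coroot_α_self, smul_eq_mul]; ring

lemma mval_eq (f : ℝ → V) : K.mval i f = runMin (K.H i f) 0 1 := rfl

end

variable {K : KacMoodyData I V} {i : I} {m : ℕ} {f : ℝ → V} {x : ℝ}

lemma H_raiseTo : K.H i (K.raiseTo i x f) = pitman x (K.H i f) := by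
  ext t
  simp only [H, raiseTo, pitman, map_add, map_smul, coroot_α_self, smul_eq_mul]
  ring_nf

lemma H_lowerTo : K.H i (K.lowerTo i x f) = fun t =>
    pitmanR x (K.H i f) t - 2 * max 0 (x - runMin (K.H i f) 0 1) := by
  ext t
  simp only [H, lowerTo, pitmanR, map_add, map_smul, coroot_α_self, smul_eq_mul]
  ring_nf

namespace IntegralPath

lemma H_zero (hf : K.IntegralPath i m f) : K.H i f 0 = 0 := by simp [H, hf.zero]

lemma H_one (hf : K.IntegralPath i m f) (hm : 1 ≤ m) : IsInt (K.H i f 1) := by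
  have := hf.int m le_rfl
  rwa [div_self (by positivity)] at this

lemma runMin_left_int (hf : K.IntegralPath i m f) {k : ℕ} (hk : k ≤ m) :
    IsInt (runMin (K.H i f) 0 ((k : ℝ) / m)) := by
  have h1 : (k : ℝ) / m ≤ 1 := div_le_one_of_le₀ (by exact_mod_cast hk) (by positivity)
  rcases hf.intMin 0 _ le_rfl (by positivity) h1 with h | h | h
  · exact h
  · rw [h, hf.H_zero]; exact IsInt.zero
  · rw [h]; exact hf.int k hk

lemma runMin_right_int (hf : K.IntegralPath i m f) (hm : 1 ≤ m) {k : ℕ} (hk : k ≤ m) :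
    IsInt (runMin (K.H i f) ((k : ℝ) / m) 1) := by
  have h1 : (k : ℝ) / m ≤ 1 := div_le_one_of_le₀ (by exact_mod_cast hk) (by positivity)
  rcases hf.intMin _ 1 (by positivity) h1 le_rfl with h | h | h
  · exact h
  · rw [h]; exact hf.int k hk
  · rw [h]; exact hf.H_one hm

lemma runMin_int (hf : K.IntegralPath i m f) (hm : 1 ≤ m) :
    IsInt (runMin (K.H i f) 0 1) := by
  simpa using hf.runMin_right_int hm (Nat.zero_le m)

lemma runMin_nonpos (hf : K.IntegralPath i m f) : runMin (K.H i f) 0 1 ≤ 0 := by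
  exact (runMin_le hf.cont le_rfl zero_le_one).trans hf.H_zero.le

lemma runMin_le_one (hf : K.IntegralPath i m f) : runMin (K.H i f) 0 1 ≤ K.H i f 1 :=
  runMin_le hf.cont zero_le_one le_rfl

lemma raiseTo (hf : K.IntegralPath i m f) (hx : IsInt x) (hx0 : x ≤ 0) :
    K.IntegralPath i m (K.raiseTo i x f) where
  cont := by rw [H_raiseTo]; exact pitman_continuous hf.cont x
  zero := by
    rw [KacMoodyData.raiseTo, clamp01_of_nonpos le_rfl, runMin_self, hf.zero, hf.H_zero,
      max_eq_left (by linarith)]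
    simp
  clamp t := by
    simp only [KacMoodyData.raiseTo]
    rw [hf.clamp t, clamp01_of_mem (clamp01_nonneg t) (clamp01_le_one t)]
  intMin := by
    rw [H_raiseTo]
    exact pitman_intMin hf.cont hx (by rw [hf.H_zero]; exact IsInt.zero)
      hf.intMin
  int k hk := by
    have h1 : (k : ℝ) / m ≤ 1 := div_le_one_of_le₀ (by exact_mod_cast hk) (by positivity)
    rw [H_raiseTo, pitman_apply (by positivity) h1]
    exact (hf.int k hk).add (IsInt.mul ⟨2, by simp⟩
      (IsInt.zero.max (hx.sub (hf.runMin_left_int hk))))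

lemma lowerTo (hf : K.IntegralPath i m f) (hm : 1 ≤ m) (hx : IsInt x) :
    K.IntegralPath i m (K.lowerTo i x f) where
  cont := by
    rw [H_lowerTo]
    have := pitmanR_continuous hf.cont x
    fun_prop
  zero := by
    rw [KacMoodyData.lowerTo, clamp01_of_nonpos le_rfl, hf.zero]
    simp
  clamp t := by
    simp only [KacMoodyData.lowerTo]
    rw [hf.clamp t, clamp01_of_mem (clamp01_nonneg t) (clamp01_le_one t)]
  intMin := by
    rw [H_lowerTo]
    exact (pitmanR_intMin hf.cont hx (hf.H_one hm) hf.intMin).sub_const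
      (pitmanR_continuous hf.cont x)
      (IsInt.mul ⟨2, by simp⟩ (IsInt.zero.max (hx.sub (hf.runMin_int hm))))
  int k hk := by
    have h1 : (k : ℝ) / m ≤ 1 := div_le_one_of_le₀ (by exact_mod_cast hk) (by positivity)
    rw [H_lowerTo]
    simp only [pitmanR]
    rw [clamp01_of_mem (by positivity) h1]
    exact ((hf.int k hk).add (IsInt.mul ⟨2, by simp⟩
      (IsInt.zero.max (hx.sub (hf.runMin_right_int hm hk))))).sub
      (IsInt.mul ⟨2, by simp⟩ (IsInt.zero.max (hx.sub (hf.runMin_int hm))))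

lemma eraw_eq (hf : K.IntegralPath i m f) (hm : 1 ≤ m)
    (hN : runMin (K.H i f) 0 1 < 0) :
    K.eraw i f = K.raiseTo i (runMin (K.H i f) 0 1 + 1) f := by
  have hc := hf.cont
  have hNi := hf.runMin_int hm
  have hN1 := hNi.add_one_le IsInt.zero hN
  have h00 := hf.H_zero
  set h := K.H i f with hh
  set N := runMin h 0 1 with hNdef
  set S1 := {t | t ∈ Set.Icc (0 : ℝ) 1 ∧ h t = N}
  set t1 := sInf S1 with ht1
  set S0 := {t | t ∈ Set.Icc (0 : ℝ) t1 ∧ h t = N + 1}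
  set t0 := sSup S0 with ht0
  have hS1 : IsCompact S1 := isCompact_Icc.inter_right (isClosed_eq hc continuous_const)
  have hS0 : IsCompact S0 := isCompact_Icc.inter_right (isClosed_eq hc continuous_const)
  obtain ⟨u, hu0, hu1, hu⟩ := exists_eq_runMin hc (zero_le_one (α := ℝ))
  obtain ⟨⟨ht10, ht11⟩, ht1N⟩ : t1 ∈ S1 := hS1.sInf_mem ⟨u, ⟨hu0, hu1⟩, hu⟩
  have hbefore : ∀ t, 0 ≤ t → t < t1 → N < h t := by
    intro t h0 h1
    refine lt_of_le_of_ne (runMin_le hc h0 (h1.le.trans ht11)) fun e => ?_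
    exact h1.not_ge (csInf_le hS1.bddBelow ⟨⟨h0, h1.le.trans ht11⟩, e.symm⟩)
  obtain ⟨⟨ht00, ht01⟩, ht0N⟩ : t0 ∈ S0 := by
    refine hS0.sSup_mem ?_
    obtain ⟨e, he, hey⟩ := intermediate_value_Icc' ht10 hc.continuousOn
      (show N + 1 ∈ Set.Icc (h t1) (h 0) from ⟨by linarith, by linarith⟩)
    exact ⟨e, he, hey⟩
  have ht01' : t0 < t1 := lt_of_le_of_ne ht01 fun e => by rw [e, ht1N] at ht0N; linarith
  have hI1 : runMin h 0 t1 = N :=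
    le_antisymm (ht1N ▸ runMin_le hc ht10 le_rfl) (runMin_anti_right hc ht10 ht11)
  have hIgt : ∀ t, 0 ≤ t → t < t1 → N < runMin h 0 t := by
    intro t h0 h1
    obtain ⟨s, hs0, hs1, hs⟩ := exists_eq_runMin hc h0
    rw [← hs]
    exact hbefore s hs0 (hs1.trans_lt h1)
  have hI0 : N + 1 ≤ runMin h 0 t0 := by
    rcases hf.intMin 0 t0 le_rfl ht00 (ht01.trans ht11) with e | e | e
    · exact hNi.add_one_le e (hIgt t0 ht00 ht01')
    · rw [e, ← hh]; linarith
    · rw [e, ← hh]; linarith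
  ext t
  have hE : K.raiseTo i (N + 1) f t =
    f t + max 0 (N + 1 - runMin h 0 (clamp01 t)) • K.α i := rfl
  have hR : K.eraw i f t = if t ≤ t0 then f t
    else if t ≤ t1 then K.refl i (f t - f t0) + f t0 else f t + K.α i := rfl
  rw [hE, hR]
  split_ifs with c0 c1
  · have hcl : clamp01 t ≤ t0 := by
      rcases le_total t 0 with h' | h'
      · rwa [clamp01_of_nonpos h']
      · rwa [clamp01_of_mem h' (c0.trans (ht01.trans ht11))]
    rw [max_eq_left]
    · simp
    · linarith [runMin_anti_right hc (clamp01_nonneg t) hcl]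
  · push Not at c0
    have htp : 0 ≤ t := ht00.trans c0.le
    rw [clamp01_of_mem htp (c1.trans ht11)]
    have hlt : h t < N + 1 := by
      by_contra! hge
      obtain ⟨s, hs, hsy⟩ := intermediate_value_Icc' c1 hc.continuousOn
        (show N + 1 ∈ Set.Icc (h t1) (h t) from ⟨by linarith, hge⟩)
      have : s ≤ t0 := le_csSup hS0.bddAbove ⟨⟨htp.trans hs.1, hs.2⟩, hsy⟩
      linarith [hs.1]
    have hI : runMin h 0 t = h t := by
      rcases c1.eq_or_lt with e | c1
      · rw [e, hI1, ht1N]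
      have hle := runMin_le hc htp le_rfl
      rcases hf.intMin 0 t le_rfl htp (c1.le.trans ht11) with e | e | e
      · have := hNi.add_one_le e (hIgt t htp c1)
        linarith
      · rw [← hh, h00] at e; linarith
      · exact e
    rw [hI, max_eq_right (by linarith), refl_apply, map_sub]
    change f t - f t0 - (h t - h t0) • K.α i + f t0 = _
    rw [ht0N]
    module
  · push Not at c1
    have hcl : t1 ≤ clamp01 t := by
      rcases le_total t 1 with h' | h'
      · rw [clamp01_of_mem (ht10.trans c1.le) h']; exact c1.le
      · rwa [clamp01_of_one_le h']
    have : runMin h 0 (clamp01 t) = N :=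
      le_antisymm (hI1 ▸ runMin_anti_right hc ht10 hcl)
        (runMin_anti_right hc (clamp01_nonneg t) (clamp01_le_one t))
    rw [this]
    simp

lemma fraw_eq (hf : K.IntegralPath i m f) (hm : 1 ≤ m)
    (hN : runMin (K.H i f) 0 1 < K.H i f 1) :
    K.fraw i f = K.lowerTo i (runMin (K.H i f) 0 1 + 1) f := by
  have hc := hf.cont
  have hNi := hf.runMin_int hm
  have hN1 := hNi.add_one_le (hf.H_one hm) hN
  set h := K.H i f with hh
  set N := runMin h 0 1 with hNdef
  set S0 := {t | t ∈ Set.Icc (0 : ℝ) 1 ∧ h t = N}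
  set t0 := sSup S0 with ht0
  set S1 := {t | t ∈ Set.Icc t0 1 ∧ h t = N + 1}
  set t1 := sInf S1 with ht1
  have hS1 : IsCompact S1 := isCompact_Icc.inter_right (isClosed_eq hc continuous_const)
  have hS0 : IsCompact S0 := isCompact_Icc.inter_right (isClosed_eq hc continuous_const)
  obtain ⟨u, hu0, hu1, hu⟩ := exists_eq_runMin hc (zero_le_one (α := ℝ))
  obtain ⟨⟨ht00, ht01⟩, ht0N⟩ : t0 ∈ S0 := hS0.sSup_mem ⟨u, ⟨hu0, hu1⟩, hu⟩
  have hafter : ∀ t, t0 < t → t ≤ 1 → N < h t := by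
    intro t h0 h1
    refine lt_of_le_of_ne (runMin_le hc (ht00.trans h0.le) h1) fun e => ?_
    exact h0.not_ge (le_csSup hS0.bddAbove ⟨⟨ht00.trans h0.le, h1⟩, e.symm⟩)
  obtain ⟨⟨ht10, ht11⟩, ht1N⟩ : t1 ∈ S1 := by
    refine hS1.sInf_mem ?_
    obtain ⟨e, he, hey⟩ := intermediate_value_Icc ht01 hc.continuousOn
      (show N + 1 ∈ Set.Icc (h t0) (h 1) from ⟨by linarith, by linarith⟩)
    exact ⟨e, he, hey⟩
  have ht10' : t0 < t1 := lt_of_le_of_ne ht10 fun e => by rw [← e, ht0N] at ht1N; linarith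
  have hJ0 : runMin h t0 1 = N :=
    le_antisymm (ht0N ▸ runMin_le hc le_rfl ht01) (runMin_mono_left hc ht00 ht01)
  have hJgt : ∀ t, t0 < t → t ≤ 1 → N < runMin h t 1 := by
    intro t h0 h1
    obtain ⟨s, hs0, hs1, hs⟩ := exists_eq_runMin hc h1
    rw [← hs]
    exact hafter s (h0.trans_le hs0) hs1
  have hJ1 : N + 1 ≤ runMin h t1 1 := by
    rcases hf.intMin t1 1 (ht00.trans ht10) ht11 le_rfl with e | e | e
    · exact hNi.add_one_le e (hJgt t1 ht10' ht11)
    · rw [e, ← hh]; linarith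
    · rw [e, ← hh]; linarith
  ext t
  have hE : K.lowerTo i (N + 1) f t =
    f t + (max 0 (N + 1 - runMin h (clamp01 t) 1) - max 0 (N + 1 - N)) • K.α i := rfl
  have hR : K.fraw i f t = if t ≤ t0 then f t
    else if t ≤ t1 then K.refl i (f t - f t0) + f t0 else f t - K.α i := rfl
  rw [hE, hR, add_sub_cancel_left, max_eq_right zero_le_one]
  split_ifs with c0 c1
  · have hcl : clamp01 t ≤ t0 := by
      rcases le_total t 0 with h' | h'
      · rwa [clamp01_of_nonpos h']
      · rwa [clamp01_of_mem h' (c0.trans ht01)]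
    have : runMin h (clamp01 t) 1 = N :=
      le_antisymm (hJ0 ▸ runMin_mono_left hc hcl ht01)
        (runMin_mono_left hc (clamp01_nonneg t) (clamp01_le_one t))
    rw [this]
    simp
  · push Not at c0
    have htp : 0 ≤ t := ht00.trans c0.le
    have htp1 : t ≤ 1 := c1.trans ht11
    rw [clamp01_of_mem htp htp1]
    have hle1 : h t ≤ N + 1 := by
      by_contra! hge
      obtain ⟨s, hs, hsy⟩ := intermediate_value_Icc c0.le hc.continuousOn
        (show N + 1 ∈ Set.Icc (h t0) (h t) from ⟨by linarith, hge.le⟩)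
      have : t1 ≤ s := csInf_le hS1.bddBelow ⟨⟨hs.1, hs.2.trans htp1⟩, hsy⟩
      have : s = t := by linarith [hs.2]
      rw [this] at hsy
      linarith
    have hJ : runMin h t 1 = h t := by
      have hle := runMin_le hc le_rfl htp1
      rcases hf.intMin t 1 htp htp1 le_rfl with e | e | e
      · have := hNi.add_one_le e (hJgt t c0 htp1)
        linarith
      · exact e
      · rw [← hh] at e; linarith
    rw [hJ, max_eq_right (by linarith), refl_apply, map_sub]
    change f t - f t0 - (h t - h t0) • K.α i + f t0 = _
    rw [ht0N]
    module
  · push Not at c1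
    have hcl : t1 ≤ clamp01 t := by
      rcases le_total t 1 with h' | h'
      · rw [clamp01_of_mem (ht00.trans (ht10.trans c1.le)) h']; exact c1.le
      · rwa [clamp01_of_one_le h']
    rw [max_eq_left]
    · module
    · linarith [runMin_mono_left hc hcl (clamp01_le_one t)]

lemma eop_eq (hf : K.IntegralPath i m f) (hm : 1 ≤ m) :
    K.eop i f = if runMin (K.H i f) 0 1 = 0 then none else
      some (K.raiseTo i (runMin (K.H i f) 0 1 + 1) f) := by
  rw [eop, mval_eq]
  split_ifs with h
  · rfl
  · rw [hf.eraw_eq hm (lt_of_le_of_ne hf.runMin_nonpos h)]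

lemma fop_eq (hf : K.IntegralPath i m f) (hm : 1 ≤ m) :
    K.fop i f = if runMin (K.H i f) 0 1 = K.H i f 1 then none else
      some (K.lowerTo i (runMin (K.H i f) 0 1 + 1) f) := by
  rw [fop, mval_eq]
  simp only [sub_eq_zero, eq_comm (a := K.H i f 1)]
  split_ifs with h
  · rfl
  · rw [hf.fraw_eq hm (lt_of_le_of_ne hf.runMin_le_one h)]

lemma runMin_raiseTo (hf : K.IntegralPath i m f) (hx : x ≤ 0) {t : ℝ} (h0 : 0 ≤ t)
    (h1 : t ≤ 1) :
    runMin (K.H i (K.raiseTo i x f)) 0 t = max (runMin (K.H i f) 0 t) x := by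
  rw [H_raiseTo, runMin_pitman hf.cont (by rwa [hf.H_zero]) h0 h1]

lemma runMin_lowerTo (hf : K.IntegralPath i m f) (hx : x ≤ K.H i f 1) {t : ℝ} (h0 : 0 ≤ t)
    (h1 : t ≤ 1) :
    runMin (K.H i (K.lowerTo i x f)) t 1 =
      max (runMin (K.H i f) t 1) x - 2 * max 0 (x - runMin (K.H i f) 0 1) := by
  rw [H_lowerTo, runMin_sub_const (pitmanR_continuous hf.cont x) h1,
    runMin_pitmanR hf.cont hx h0 h1]

lemma H_one_lowerTo (hx : x ≤ K.H i f 1) :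
    K.H i (K.lowerTo i x f) 1 = K.H i f 1 - 2 * max 0 (x - runMin (K.H i f) 0 1) := by
  rw [H_lowerTo]
  simp only [pitmanR]
  rw [clamp01_of_one_le le_rfl, runMin_self, max_eq_left (by linarith)]
  ring

end IntegralPath

lemma iterate_bind_none {α : Type*} (g : α → Option α) (n : ℕ) :
    (fun o : Option α => o.bind g)^[n] none = none := by
  induction n with
  | zero => rfl
  | succ n ih => rw [Function.iterate_succ_apply]; exact ih

lemma eIter_succ (n : ℕ) (f : ℝ → V) :
    K.eIter i (n + 1) f = (K.eop i f).bind (K.eIter i n) := by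
  rw [eIter, Function.iterate_succ_apply, Option.bind_some]
  cases K.eop i f with
  | none => exact iterate_bind_none _ n
  | some g => rfl

lemma fIter_succ (n : ℕ) (f : ℝ → V) :
    K.fIter i (n + 1) f = (K.fop i f).bind (K.fIter i n) := by
  rw [fIter, Function.iterate_succ_apply, Option.bind_some]
  cases K.fop i f with
  | none => exact iterate_bind_none _ n
  | some g => rfl

lemma sSup_setOf_natCast_le {P : ℕ → Prop} {y : ℝ} (hy : IsInt y) (hy0 : 0 ≤ y)
    (h : ∀ n, P n ↔ (n : ℝ) ≤ y) : ((sSup {n | P n} : ℕ) : ℝ) = y := by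
  obtain ⟨z, rfl⟩ := hy
  obtain ⟨k, rfl⟩ := Int.eq_ofNat_of_zero_le (show 0 ≤ z by exact_mod_cast hy0)
  have : {n | P n} = Set.Iic k := by
    ext n
    rw [Set.mem_ofPred_eq, h]
    simp
  rw [this, csSup_Iic]
  simp

namespace IntegralPath

lemma eIter_ne_none_iff (hf : K.IntegralPath i m f) (hm : 1 ≤ m) (n : ℕ) :
    K.eIter i n f ≠ none ↔ (n : ℝ) ≤ -runMin (K.H i f) 0 1 := by
  induction n generalizing f with
  | zero => simpa [eIter] using hf.runMin_nonpos
  | succ n ih =>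
    have hi := hf.runMin_int hm
    rw [eIter_succ, hf.eop_eq hm]
    split_ifs with h
    · rw [h]
      simp only [Option.bind_none, ne_eq, not_true_eq_false, false_iff, neg_zero]
      push_cast
      linarith [n.cast_nonneg (α := ℝ)]
    · have h1 := hi.add_one_le IsInt.zero (lt_of_le_of_ne hf.runMin_nonpos h)
      rw [Option.bind_some, ih (hf.raiseTo (hi.add IsInt.one) h1),
        hf.runMin_raiseTo h1 zero_le_one le_rfl, max_eq_right (by linarith)]
      push_cast
      constructor <;> intro <;> linarith

lemma fIter_ne_none_iff (hf : K.IntegralPath i m f) (hm : 1 ≤ m) (n : ℕ) :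
    K.fIter i n f ≠ none ↔ (n : ℝ) ≤ K.H i f 1 - runMin (K.H i f) 0 1 := by
  induction n generalizing f with
  | zero => simpa [fIter] using hf.runMin_le_one
  | succ n ih =>
    have hi := hf.runMin_int hm
    rw [fIter_succ, hf.fop_eq hm]
    split_ifs with h
    · rw [h]
      simp only [Option.bind_none, ne_eq, not_true_eq_false, false_iff, sub_self]
      push_cast
      linarith [n.cast_nonneg (α := ℝ)]
    · have h1 := hi.add_one_le (hf.H_one hm) (lt_of_le_of_ne hf.runMin_le_one h)
      rw [Option.bind_some, ih (hf.lowerTo hm (hi.add IsInt.one)),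
        hf.runMin_lowerTo h1 le_rfl zero_le_one, H_one_lowerTo h1,
        max_eq_right (a := 0) (by linarith), max_eq_right (by linarith)]
      push_cast
      constructor <;> intro <;> linarith

lemma epsilon_eq (hf : K.IntegralPath i m f) (hm : 1 ≤ m) :
    (K.epsilon i f : ℝ) = -runMin (K.H i f) 0 1 :=
  sSup_setOf_natCast_le (hf.runMin_int hm).neg (by linarith [hf.runMin_nonpos])
    (hf.eIter_ne_none_iff hm)

lemma phi_eq (hf : K.IntegralPath i m f) (hm : 1 ≤ m) :
    (K.phi i f : ℝ) = K.H i f 1 - runMin (K.H i f) 0 1 :=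
  sSup_setOf_natCast_le ((hf.H_one hm).sub (hf.runMin_int hm))
    (by linarith [hf.runMin_le_one]) (hf.fIter_ne_none_iff hm)

end IntegralPath

end KacMoodyData

lemma runMin_affine (h : ℝ → ℝ) {m : ℕ} (hm : 1 ≤ m) (k a b : ℝ) :
    runMin (fun t => h ((t + k) / m)) a b = runMin h ((a + k) / m) ((b + k) / m) := by
  have hm' : (0 : ℝ) < m := by exact_mod_cast hm
  have e : (fun t => (t + k) / (m : ℝ)) = fun t => (m : ℝ)⁻¹ * t + k / m := by
    ext t; field_simp
  unfold runMin
  rw [← Set.image_image (g := h) (f := fun t => (t + k) / (m : ℝ)), e,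
    Set.image_affine_Icc' (inv_pos.2 hm')]
  congr 3 <;> field_simp

section segments

variable {V : Type*} [AddCommGroup V] [Module ℝ V]

/-- The `k`-th of `m` pieces of a path. -/
def piece (m : ℕ) (g : ℝ → V) (k : ℕ) : ℝ → V := fun t =>
  g ((clamp01 t + k) / m) - g ((k : ℝ) / m)

/-- The list of the `n` consecutive pieces of a path starting from the `k`-th one. -/
def segments (m : ℕ) (g : ℝ → V) : ℕ → ℕ → List (ℝ → V)
  | _, 0 => []
  | k, n + 1 => piece m g k :: segments m g (k + 1) n

lemma segments_eq_ofFn (m : ℕ) (g : ℝ → V) (k n : ℕ) :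
    segments m g k n = List.ofFn fun j : Fin n => piece m g (k + j) := by
  induction n generalizing k with
  | zero => simp [segments]
  | succ n ih =>
    rw [segments, ih, List.ofFn_succ]
    simp [add_comm, add_left_comm]

lemma subdiv_eq_segments (m : ℕ) (g : ℝ → V) : subdiv m g = segments m g 0 m := by
  simp only [segments_eq_ofFn, zero_add]
  rfl

lemma segments_congr {m : ℕ} {g g' : ℝ → V} {k n : ℕ}
    (h : ∀ j, k ≤ j → j < k + n → piece m g j = piece m g' j) :
    segments m g k n = segments m g' k n := by
  rw [segments_eq_ofFn, segments_eq_ofFn]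
  congr 1
  ext1 j
  exact h _ (by omega) (by omega)

lemma piece_one {m : ℕ} {g : ℝ → V} {k : ℕ} :
    piece m g k 1 = g (((k + 1 : ℕ) : ℝ) / m) - g ((k : ℝ) / m) := by
  rw [piece, clamp01_of_one_le le_rfl]
  push_cast
  rw [add_comm]

lemma tensWt_segments (m : ℕ) (g : ℝ → V) (k n : ℕ) :
    tensWt (segments m g k n) = g (((k + n : ℕ) : ℝ) / m) - g ((k : ℝ) / m) := by
  induction n generalizing k with
  | zero => simp [segments, tensWt]
  | succ n ih =>
    have := ih (k + 1)
    simp only [tensWt] at this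
    rw [segments, tensWt, List.map_cons, List.sum_cons, this, piece_one,
      show k + 1 + n = k + (n + 1) by ring]
    abel

lemma natCast_div_self {m k : ℕ} (hk : k < m) : (m : ℝ) / m = 1 :=
  div_self (by exact_mod_cast (by omega : m ≠ 0))

lemma div_add_le_one {m k : ℕ} (hm : 1 ≤ m) (hk : k < m) {t : ℝ} (h1 : t ≤ 1) :
    (t + k) / m ≤ 1 := by
  rw [div_le_one (by positivity)]
  have : (k : ℝ) + 1 ≤ m := by exact_mod_cast hk
  linarith

end segments

namespace KacMoodyData

variable {I V : Type*} [Fintype I] [DecidableEq I] [AddCommGroup V] [Module ℝ V]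
variable {K : KacMoodyData I V} {i : I} {m : ℕ} {g : ℝ → V} {x : ℝ} {k : ℕ}

lemma H_piece (m : ℕ) (g : ℝ → V) (k : ℕ) : K.H i (piece m g k) =
    fun t => K.H i g ((clamp01 t + k) / m) - K.H i g ((k : ℝ) / m) := by
  ext t; simp [H, piece]

lemma runMin_piece (hc : Continuous (K.H i g)) (hm : 1 ≤ m) {a b : ℝ} (ha : 0 ≤ a)
    (hab : a ≤ b) (hb : b ≤ 1) :
    runMin (K.H i (piece m g k)) a b =
      runMin (K.H i g) ((a + k) / m) ((b + k) / m) - K.H i g ((k : ℝ) / m) := by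
  have := continuous_clamp01
  rw [H_piece, runMin_sub_const (h := fun t => K.H i g ((clamp01 t + k) / m))
    (hc.comp (by fun_prop)) hab, ← runMin_affine _ hm]
  congr 1
  exact runMin_congr fun t h0 h1 => by rw [clamp01_of_mem (ha.trans h0) (h1.trans hb)]

lemma tensEps_cons (b : ℝ → V) {l : List (ℝ → V)} (hl : l ≠ []) :
    K.tensEps i (b :: l) = max ((K.epsilon i b : ℤ)) (K.tensEps i l - ⌊K.coroot i (b 1)⌋) := by
  cases l with
  | nil => exact absurd rfl hl
  | cons c r => rfl

lemma tensPhi_cons (b : ℝ → V) {l : List (ℝ → V)} (hl : l ≠ []) :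
    K.tensPhi i (b :: l) =
      max (K.tensPhi i l) ((K.phi i b : ℤ) + ⌊K.coroot i (tensWt l)⌋) := by
  cases l with
  | nil => exact absurd rfl hl
  | cons c r => rfl

lemma tensE_cons (b : ℝ → V) {l : List (ℝ → V)} (hl : l ≠ []) :
    K.tensE i (b :: l) = if K.tensEps i l ≤ (K.phi i b : ℤ) then
      (K.eop i b).map fun b' => b' :: l else (K.tensE i l).map fun r' => b :: r' := by
  cases l with
  | nil => exact absurd rfl hl
  | cons c r => rfl

lemma tensF_cons (b : ℝ → V) {l : List (ℝ → V)} (hl : l ≠ []) :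
    K.tensF i (b :: l) = if K.tensEps i l < (K.phi i b : ℤ) then
      (K.fop i b).map fun b' => b' :: l else (K.tensF i l).map fun r' => b :: r' := by
  cases l with
  | nil => exact absurd rfl hl
  | cons c r => rfl

lemma segments_succ_ne_nil (m : ℕ) (g : ℝ → V) (k n : ℕ) : segments m g k (n + 1) ≠ [] := by
  simp [segments]

namespace IntegralPath

lemma piece (hg : K.IntegralPath i m g) (hk : k < m) :
    K.IntegralPath i 1 (piece m g k) where
  cont := by
    rw [H_piece]
    have := continuous_clamp01
    exact (hg.cont.comp (f := fun t => (clamp01 t + k) / m) (by fun_prop)).sub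
      continuous_const
  zero := by simp [LSPaper.piece, clamp01_of_nonpos le_rfl]
  clamp t := by
    simp only [LSPaper.piece]
    rw [clamp01_of_mem (clamp01_nonneg t) (clamp01_le_one t)]
  intMin a b ha hab hb := by
    have hm : 1 ≤ m := by omega
    have hi := hg.int k hk.le
    rw [runMin_piece hg.cont hm ha hab hb, H_piece]
    simp only
    rw [clamp01_of_mem ha (hab.trans hb), clamp01_of_mem (ha.trans hab) hb]
    rcases hg.intMin ((a + k) / m) ((b + k) / m) (by positivity) (by gcongr)
      (div_add_le_one hm hk hb) with h | h | h
    · exact Or.inl (h.sub hi)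
    · exact Or.inr (Or.inl (by rw [h]))
    · exact Or.inr (Or.inr (by rw [h]))
  int j hj := by
    rw [H_piece]
    interval_cases j
    · simp [clamp01_of_nonpos le_rfl, IsInt.zero]
    · have := hg.int (k + 1) hk
      simp only [Nat.cast_one, div_one]
      rw [clamp01_of_one_le le_rfl, add_comm]
      push_cast at this
      exact this.sub (hg.int k hk.le)

lemma runMin_piece_zero_one (hg : K.IntegralPath i m g) (hk : k < m) :
    runMin (K.H i (LSPaper.piece m g k)) 0 1 =
      runMin (K.H i g) ((k : ℝ) / m) (((k + 1 : ℕ) : ℝ) / m) - K.H i g ((k : ℝ) / m) := by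
  rw [runMin_piece hg.cont (by omega) le_rfl zero_le_one le_rfl]
  push_cast
  rw [zero_add, add_comm 1]

lemma H_piece_one (m : ℕ) (g : ℝ → V) (k : ℕ) :
    K.H i (LSPaper.piece m g k) 1 = K.H i g (((k + 1 : ℕ) : ℝ) / m) - K.H i g ((k : ℝ) / m) := by
  rw [H, piece_one, map_sub]; rfl

lemma node_le (hk : k < m) : (k : ℝ) / m ≤ ((k + 1 : ℕ) : ℝ) / m ∧
    ((k + 1 : ℕ) : ℝ) / m ≤ 1 := by
  refine ⟨by gcongr; omega, div_le_one_of_le₀ (by exact_mod_cast hk) (by positivity)⟩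

lemma runMin_node_split (hg : K.IntegralPath i m g) (hk : k < m) :
    runMin (K.H i g) ((k : ℝ) / m) 1 =
      min (runMin (K.H i g) ((k : ℝ) / m) (((k + 1 : ℕ) : ℝ) / m))
        (runMin (K.H i g) (((k + 1 : ℕ) : ℝ) / m) 1) :=
  runMin_split hg.cont (node_le hk).1 (node_le hk).2

lemma epsilon_piece (hg : K.IntegralPath i m g) (hk : k < m) :
    (K.epsilon i (LSPaper.piece m g k) : ℝ) = K.H i g ((k : ℝ) / m) -
      runMin (K.H i g) ((k : ℝ) / m) (((k + 1 : ℕ) : ℝ) / m) := by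
  rw [(hg.piece hk).epsilon_eq le_rfl, hg.runMin_piece_zero_one hk]; ring

lemma phi_piece (hg : K.IntegralPath i m g) (hk : k < m) :
    (K.phi i (LSPaper.piece m g k) : ℝ) = K.H i g (((k + 1 : ℕ) : ℝ) / m) -
      runMin (K.H i g) ((k : ℝ) / m) (((k + 1 : ℕ) : ℝ) / m) := by
  rw [(hg.piece hk).phi_eq le_rfl, hg.runMin_piece_zero_one hk, H_piece_one]; ring

lemma tensEps_segments (hg : K.IntegralPath i m g) (n : ℕ) (hkn : k + (n + 1) = m) :
    (K.tensEps i (segments m g k (n + 1)) : ℝ) =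
      K.H i g ((k : ℝ) / m) - runMin (K.H i g) ((k : ℝ) / m) 1 := by
  have hk : k < m := by omega
  induction n generalizing k with
  | zero =>
    rw [segments, segments, tensEps]
    push_cast
    rw [hg.epsilon_piece hk, show k + 1 = m by omega, natCast_div_self hk]
  | succ n ih =>
    have h1 : K.coroot i (LSPaper.piece m g k 1) = _ := H_piece_one (K := K) m g k
    have h2 := (hg.int (k + 1) hk).sub (hg.int k hk.le)
    rw [segments, tensEps_cons _ (segments_succ_ne_nil _ _ _ _)]
    push_cast
    rw [ih (k := k + 1) (by omega) (by omega), hg.epsilon_piece hk, h1, h2.cast_floor,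
      hg.runMin_node_split hk, ← max_sub_sub_left]
    congr 1
    ring

lemma tensPhi_segments (hg : K.IntegralPath i m g) (n : ℕ) (hkn : k + (n + 1) = m) :
    (K.tensPhi i (segments m g k (n + 1)) : ℝ) =
      K.H i g 1 - runMin (K.H i g) ((k : ℝ) / m) 1 := by
  have hk : k < m := by omega
  have hm : (m : ℝ) / m = 1 := natCast_div_self hk
  induction n generalizing k with
  | zero =>
    rw [segments, segments, tensPhi]
    push_cast
    rw [hg.phi_piece hk, show k + 1 = m by omega, hm]
  | succ n ih =>
    have h1 : K.coroot i (tensWt (segments m g (k + 1) (n + 1))) =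
        K.H i g 1 - K.H i g (((k + 1 : ℕ) : ℝ) / m) := by
      rw [tensWt_segments, map_sub, show k + 1 + (n + 1) = m by omega, hm]
      rfl
    have h2 := (hg.H_one (by omega)).sub (hg.int (k + 1) hk)
    rw [segments, tensPhi_cons _ (segments_succ_ne_nil _ _ _ _)]
    push_cast
    rw [ih (k := k + 1) (by omega) (by omega), hg.phi_piece hk, h1, h2.cast_floor,
      hg.runMin_node_split hk, ← max_sub_sub_left, max_comm]
    congr 1
    ring

lemma runMin_node_int (hg : K.IntegralPath i m g) (hk : k < m) :
    IsInt (runMin (K.H i g) ((k : ℝ) / m) (((k + 1 : ℕ) : ℝ) / m)) := by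
  rcases hg.intMin _ _ (by positivity) (node_le hk).1 (node_le hk).2 with h | h | h
  · exact h
  · rw [h]; exact hg.int k hk.le
  · rw [h]; exact hg.int (k + 1) hk

/-- Position of a point of the `k`-th piece inside the whole path. -/
lemma node_mem (hk : k < m) (t : ℝ) : (k : ℝ) / m ≤ (clamp01 t + k) / m ∧
    (clamp01 t + k) / m ≤ ((k + 1 : ℕ) : ℝ) / m ∧ (clamp01 t + k) / m ≤ 1 ∧
    0 ≤ (clamp01 t + k) / m := by
  have h0 := clamp01_nonneg t
  have h1 := clamp01_le_one t
  refine ⟨by gcongr; linarith, ?_, div_add_le_one (by omega) hk h1, by positivity⟩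
  gcongr; push_cast; linarith

lemma piece_raiseTo_apply (hk : k < m) (t : ℝ) :
    LSPaper.piece m (K.raiseTo i x g) k t = LSPaper.piece m g k t +
      (max 0 (x - runMin (K.H i g) 0 ((clamp01 t + k) / m)) -
        max 0 (x - runMin (K.H i g) 0 ((k : ℝ) / m))) • K.α i := by
  obtain ⟨h1, h2, h3, h4⟩ := node_mem hk t
  simp only [LSPaper.piece, KacMoodyData.raiseTo]
  rw [clamp01_of_mem h4 h3, clamp01_of_mem (by positivity) (h1.trans h3)]
  module

lemma piece_lowerTo_apply (hk : k < m) (t : ℝ) :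
    LSPaper.piece m (K.lowerTo i x g) k t = LSPaper.piece m g k t +
      (max 0 (x - runMin (K.H i g) ((clamp01 t + k) / m) 1) -
        max 0 (x - runMin (K.H i g) ((k : ℝ) / m) 1)) • K.α i := by
  obtain ⟨h1, h2, h3, h4⟩ := node_mem hk t
  simp only [LSPaper.piece, KacMoodyData.lowerTo]
  rw [clamp01_of_mem h4 h3, clamp01_of_mem (by positivity) (h1.trans h3)]
  module

lemma piece_raiseTo_of_le (hg : K.IntegralPath i m g) (hk : k < m)
    (hx : x ≤ runMin (K.H i g) 0 (((k + 1 : ℕ) : ℝ) / m)) :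
    LSPaper.piece m (K.raiseTo i x g) k = LSPaper.piece m g k := by
  ext t
  obtain ⟨h1, h2, h3, h4⟩ := node_mem hk t
  have := runMin_anti_right hg.cont h4 h2
  have := runMin_anti_right hg.cont (by positivity) (h1.trans h2)
  rw [piece_raiseTo_apply hk, max_eq_left (by linarith), max_eq_left (by linarith)]
  simp

lemma piece_raiseTo_of_eq (hg : K.IntegralPath i m g) (hk : k < m)
    (hx : runMin (K.H i g) 0 ((k : ℝ) / m) = runMin (K.H i g) 0 1) :
    LSPaper.piece m (K.raiseTo i x g) k = LSPaper.piece m g k := by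
  ext t
  obtain ⟨h1, h2, h3, h4⟩ := node_mem hk t
  have := runMin_anti_right hg.cont (by positivity) h1
  have := runMin_anti_right hg.cont h4 h3
  rw [piece_raiseTo_apply hk, show runMin (K.H i g) 0 ((clamp01 t + k) / m) =
    runMin (K.H i g) 0 ((k : ℝ) / m) by linarith]
  simp

lemma piece_raiseTo (hg : K.IntegralPath i m g) (hk : k < m)
    (hx : x ≤ runMin (K.H i g) 0 ((k : ℝ) / m)) :
    LSPaper.piece m (K.raiseTo i x g) k =
      K.raiseTo i (x - K.H i g ((k : ℝ) / m)) (LSPaper.piece m g k) := by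
  ext t
  obtain ⟨h1, h2, h3, h4⟩ := node_mem hk t
  rw [piece_raiseTo_apply hk, KacMoodyData.raiseTo, runMin_piece hg.cont (by omega) le_rfl
    (clamp01_nonneg t) (clamp01_le_one t), zero_add, runMin_split hg.cont (by positivity) h1]
  congr 2
  rw [max_eq_left (b := x - runMin (K.H i g) 0 ((k : ℝ) / m)) (by linarith),
    sub_sub_sub_cancel_right, sub_zero]
  rcases le_total (runMin (K.H i g) 0 ((k : ℝ) / m))
    (runMin (K.H i g) ((k : ℝ) / m) ((clamp01 t + k) / m)) with h | h
  · rw [min_eq_left h, max_eq_left (by linarith), max_eq_left (by linarith)]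
  · rw [min_eq_right h]

lemma piece_lowerTo_of_le (hg : K.IntegralPath i m g) (hk : k < m)
    (hx : x ≤ runMin (K.H i g) ((k : ℝ) / m) 1) :
    LSPaper.piece m (K.lowerTo i x g) k = LSPaper.piece m g k := by
  ext t
  obtain ⟨h1, h2, h3, h4⟩ := node_mem hk t
  have := runMin_mono_left hg.cont h1 h3
  rw [piece_lowerTo_apply hk, max_eq_left (by linarith), max_eq_left (by linarith)]
  simp

lemma piece_lowerTo_of_eq (hg : K.IntegralPath i m g) (hk : k < m)
    (hx : runMin (K.H i g) ((k : ℝ) / m) 1 = runMin (K.H i g) (((k + 1 : ℕ) : ℝ) / m) 1) :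
    LSPaper.piece m (K.lowerTo i x g) k = LSPaper.piece m g k := by
  ext t
  obtain ⟨h1, h2, h3, h4⟩ := node_mem hk t
  have := runMin_mono_left hg.cont h1 h3
  have := runMin_mono_left hg.cont h2 (node_le hk).2
  rw [piece_lowerTo_apply hk, show runMin (K.H i g) ((clamp01 t + k) / m) 1 =
    runMin (K.H i g) ((k : ℝ) / m) 1 by linarith]
  simp

lemma piece_lowerTo (hg : K.IntegralPath i m g) (hk : k < m)
    (hx : x ≤ runMin (K.H i g) (((k + 1 : ℕ) : ℝ) / m) 1) :
    LSPaper.piece m (K.lowerTo i x g) k =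
      K.lowerTo i (x - K.H i g ((k : ℝ) / m)) (LSPaper.piece m g k) := by
  have key : ∀ t, (k : ℝ) / m ≤ t → t ≤ ((k + 1 : ℕ) : ℝ) / m →
      max 0 (x - runMin (K.H i g) t 1) =
        max 0 (x - runMin (K.H i g) t (((k + 1 : ℕ) : ℝ) / m)) := by
    intro t h1 h2
    rw [runMin_split hg.cont h2 (node_le hk).2]
    rcases le_total (runMin (K.H i g) t (((k + 1 : ℕ) : ℝ) / m))
      (runMin (K.H i g) (((k + 1 : ℕ) : ℝ) / m) 1) with h | h
    · rw [min_eq_left h]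
    · rw [min_eq_right h, max_eq_left (by linarith), max_eq_left (by linarith)]
  ext t
  obtain ⟨h1, h2, h3, h4⟩ := node_mem hk t
  rw [piece_lowerTo_apply hk, KacMoodyData.lowerTo, runMin_piece hg.cont (by omega)
    (clamp01_nonneg t) (clamp01_le_one t) le_rfl, hg.runMin_piece_zero_one hk,
    sub_sub_sub_cancel_right, sub_sub_sub_cancel_right, key _ h1 h2,
    key _ le_rfl (node_le hk).1]
  push_cast
  rw [add_comm (k : ℝ) 1]

lemma eop_piece_map (hg : K.IntegralPath i m g) (n : ℕ) (hkn : k + (n + 1) = m)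
    (hR : runMin (K.H i g) ((k : ℝ) / m) (((k + 1 : ℕ) : ℝ) / m) ≤
      runMin (K.H i g) (((k + 1 : ℕ) : ℝ) / m) 1)
    (hI : runMin (K.H i g) ((k : ℝ) / m) 1 = K.H i g ((k : ℝ) / m) ∨
      runMin (K.H i g) ((k : ℝ) / m) 1 + 1 ≤ runMin (K.H i g) 0 ((k : ℝ) / m)) :
    ((K.eop i (LSPaper.piece m g k)).map fun b' => b' :: segments m g (k + 1) n) =
      if runMin (K.H i g) ((k : ℝ) / m) 1 = K.H i g ((k : ℝ) / m) then none else
      some (segments m (K.raiseTo i (runMin (K.H i g) ((k : ℝ) / m) 1 + 1) g) k (n + 1)) := by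
  have hk : k < m := by omega
  have hJ := hg.runMin_node_split hk
  rw [min_eq_left hR] at hJ
  rw [(hg.piece hk).eop_eq le_rfl, hg.runMin_piece_zero_one hk, ← hJ]
  simp only [sub_eq_zero]
  split_ifs with h
  · rfl
  · replace hI := hI.resolve_left h
    rw [Option.map_some, segments, hg.piece_raiseTo hk hI]
    congr 2
    · congr 1; ring
    · refine segments_congr fun j hj1 hj2 => ?_
      have hj : ((k + 1 : ℕ) : ℝ) / m ≤ (j : ℝ) / m := by gcongr
      have hj' : (j : ℝ) / m ≤ 1 :=
        div_le_one_of_le₀ (by exact_mod_cast (by omega : j ≤ m)) (by positivity)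
      refine (hg.piece_raiseTo_of_eq (by omega) (le_antisymm ?_ ?_)).symm
      · rw [runMin_split hg.cont (by positivity) ((node_le hk).1.trans (node_le hk).2),
          min_eq_right (by linarith), hJ]
        refine (runMin_anti_right hg.cont (by positivity) hj).trans ?_
        exact runMin_mono_left hg.cont (by positivity) (node_le hk).1
      · exact runMin_anti_right hg.cont (by positivity) hj'

lemma tensE_segments (hg : K.IntegralPath i m g) (n : ℕ) (hkn : k + (n + 1) = m)
    (hI : runMin (K.H i g) ((k : ℝ) / m) 1 = K.H i g ((k : ℝ) / m) ∨
      runMin (K.H i g) ((k : ℝ) / m) 1 + 1 ≤ runMin (K.H i g) 0 ((k : ℝ) / m)) :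
    K.tensE i (segments m g k (n + 1)) =
      if runMin (K.H i g) ((k : ℝ) / m) 1 = K.H i g ((k : ℝ) / m) then none else
      some (segments m (K.raiseTo i (runMin (K.H i g) ((k : ℝ) / m) 1 + 1) g) k (n + 1)) := by
  have hk : k < m := by omega
  induction n generalizing k with
  | zero =>
    rw [← hg.eop_piece_map 0 hkn _ hI]
    · rfl
    · rw [show k + 1 = m by omega, natCast_div_self hk, runMin_self]
      exact runMin_le hg.cont (div_le_one_of_le₀ (by exact_mod_cast hk.le) (by positivity)) le_rfl
  | succ n ih =>
    have hcond : K.tensEps i (segments m g (k + 1) (n + 1)) ≤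
        (K.phi i (LSPaper.piece m g k) : ℤ) ↔
        runMin (K.H i g) ((k : ℝ) / m) (((k + 1 : ℕ) : ℝ) / m) ≤
          runMin (K.H i g) (((k + 1 : ℕ) : ℝ) / m) 1 := by
      rw [← Int.cast_le (R := ℝ), hg.tensEps_segments n (by omega), Int.cast_natCast,
        hg.phi_piece hk]
      constructor <;> intro <;> linarith
    rw [segments, tensE_cons _ (segments_succ_ne_nil _ _ _ _)]
    simp only [hcond]
    split_ifs with hR h h
    · rw [hg.eop_piece_map (n + 1) hkn hR hI, if_pos h]
    · rw [hg.eop_piece_map (n + 1) hkn hR hI, if_neg h, segments]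
    all_goals
      push Not at hR
      have hJ := hg.runMin_node_split hk
      rw [min_eq_right hR.le] at hJ
    · have := runMin_le hg.cont le_rfl (node_le hk).1
      linarith
    · have hR1 := (hg.runMin_right_int (by omega) (k := k + 1) hk).add_one_le
        (hg.runMin_node_int hk) hR
      have h0 : runMin (K.H i g) ((k : ℝ) / m) 1 + 1 ≤
          runMin (K.H i g) 0 (((k + 1 : ℕ) : ℝ) / m) := by
        rw [runMin_split hg.cont (by positivity) (node_le hk).1]
        exact le_min (hI.resolve_left h) (by linarith)
      have h0' := runMin_le hg.cont (show (0 : ℝ) ≤ ((k + 1 : ℕ) : ℝ) / m by positivity) le_rfl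
      rw [ih (k := k + 1) (by omega) (Or.inr (by rwa [← hJ])) (by omega),
        if_neg (by intro e; linarith), Option.map_some, ← hJ,
        ← hg.piece_raiseTo_of_le hk h0]
      rfl

lemma fop_piece_map (hg : K.IntegralPath i m g) (n : ℕ) (hkn : k + (n + 1) = m)
    (hR : runMin (K.H i g) ((k : ℝ) / m) (((k + 1 : ℕ) : ℝ) / m) <
      runMin (K.H i g) (((k + 1 : ℕ) : ℝ) / m) 1) :
    ((K.fop i (LSPaper.piece m g k)).map fun b' => b' :: segments m g (k + 1) n) =
      some (segments m (K.lowerTo i (runMin (K.H i g) ((k : ℝ) / m) 1 + 1) g) k (n + 1)) := by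
  have hk : k < m := by omega
  have hJ := hg.runMin_node_split hk
  rw [min_eq_left hR.le] at hJ
  have hx := (hg.runMin_node_int hk).add_one_le (hg.runMin_right_int (by omega) (k := k + 1) hk) hR
  rw [← hJ] at hx
  have hH := runMin_le hg.cont le_rfl (node_le hk).2
  rw [(hg.piece hk).fop_eq le_rfl, hg.runMin_piece_zero_one hk, ← hJ, H_piece_one,
    if_neg (by intro e; linarith), Option.map_some, segments, hg.piece_lowerTo hk hx]
  congr 2
  · congr 1; ring
  · refine segments_congr fun j hj1 hj2 => ?_
    have hj : ((k + 1 : ℕ) : ℝ) / m ≤ (j : ℝ) / m := by gcongr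
    have hj' : (j : ℝ) / m ≤ 1 :=
      div_le_one_of_le₀ (by exact_mod_cast (by omega : j ≤ m)) (by positivity)
    exact (hg.piece_lowerTo_of_le (by omega) (hx.trans (runMin_mono_left hg.cont hj hj'))).symm

lemma tensF_segments (hg : K.IntegralPath i m g) (n : ℕ) (hkn : k + (n + 1) = m) :
    K.tensF i (segments m g k (n + 1)) =
      if runMin (K.H i g) ((k : ℝ) / m) 1 = K.H i g 1 then none else
      some (segments m (K.lowerTo i (runMin (K.H i g) ((k : ℝ) / m) 1 + 1) g) k (n + 1)) := by
  have hk : k < m := by omega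
  induction n generalizing k with
  | zero =>
    have e1 : ((k + 1 : ℕ) : ℝ) / m = 1 := by
      rw [show k + 1 = m by omega, natCast_div_self hk]
    have hle : runMin (K.H i g) ((k : ℝ) / m) 1 ≤ K.H i g 1 :=
      runMin_le hg.cont (div_le_one_of_le₀ (by exact_mod_cast hk.le) (by positivity)) le_rfl
    split_ifs with h
    · rw [segments, segments, tensF, (hg.piece hk).fop_eq le_rfl, hg.runMin_piece_zero_one hk,
        H_piece_one, e1, if_pos (by rw [h])]
      rfl
    · rw [← hg.fop_piece_map 0 hkn]
      · rfl
      · rw [e1, runMin_self]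
        exact lt_of_le_of_ne hle h
  | succ n ih =>
    have hcond : K.tensEps i (segments m g (k + 1) (n + 1)) <
        (K.phi i (LSPaper.piece m g k) : ℤ) ↔
        runMin (K.H i g) ((k : ℝ) / m) (((k + 1 : ℕ) : ℝ) / m) <
          runMin (K.H i g) (((k + 1 : ℕ) : ℝ) / m) 1 := by
      rw [← Int.cast_lt (R := ℝ), hg.tensEps_segments n (by omega), Int.cast_natCast,
        hg.phi_piece hk]
      constructor <;> intro <;> linarith
    have hJ := hg.runMin_node_split hk
    rw [segments, tensF_cons _ (segments_succ_ne_nil _ _ _ _)]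
    simp only [hcond]
    by_cases hR : runMin (K.H i g) ((k : ℝ) / m) (((k + 1 : ℕ) : ℝ) / m) <
          runMin (K.H i g) (((k + 1 : ℕ) : ℝ) / m) 1
    · have := runMin_le hg.cont (node_le hk).2 le_rfl
      rw [min_eq_left hR.le] at hJ
      rw [if_pos hR, hg.fop_piece_map (n + 1) hkn hR, if_neg (by intro e; linarith), segments]
    · rw [min_eq_right (not_lt.1 hR)] at hJ
      rw [if_neg hR, ih (k := k + 1) (by omega) (by omega), ← hJ,
        ← hg.piece_lowerTo_of_eq (x := runMin (K.H i g) ((k : ℝ) / m) 1 + 1) hk hJ]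
      split_ifs <;> rfl

lemma tensE_subdiv (hg : K.IntegralPath i m g) (hm : 1 ≤ m) :
    K.tensE i (subdiv m g) = if runMin (K.H i g) 0 1 = 0 then none else
      some (subdiv m (K.raiseTo i (runMin (K.H i g) 0 1 + 1) g)) := by
  obtain ⟨n, rfl⟩ := Nat.exists_eq_add_of_le' hm
  have h := hg.tensE_segments (k := 0) n (by omega)
  simp only [Nat.cast_zero, zero_div, hg.H_zero, runMin_self] at h
  rw [subdiv_eq_segments, subdiv_eq_segments]
  refine h ?_
  rcases hg.runMin_nonpos.eq_or_lt with h | h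
  · exact Or.inl h
  · exact Or.inr ((hg.runMin_int hm).add_one_le IsInt.zero h)

lemma tensF_subdiv (hg : K.IntegralPath i m g) (hm : 1 ≤ m) :
    K.tensF i (subdiv m g) = if runMin (K.H i g) 0 1 = K.H i g 1 then none else
      some (subdiv m (K.lowerTo i (runMin (K.H i g) 0 1 + 1) g)) := by
  obtain ⟨n, rfl⟩ := Nat.exists_eq_add_of_le' hm
  have h := hg.tensF_segments (k := 0) n (by omega)
  simp only [Nat.cast_zero, zero_div] at h
  rwa [subdiv_eq_segments, subdiv_eq_segments]

lemma raiseTo_raiseTo (hg : K.IntegralPath i m g) {y : ℝ} (hxy : x ≤ y) (hy : y ≤ 0) :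
    K.raiseTo i y (K.raiseTo i x g) = K.raiseTo i y g := by
  ext t
  rw [KacMoodyData.raiseTo, hg.runMin_raiseTo (hxy.trans hy) (clamp01_nonneg t)
    (clamp01_le_one t), KacMoodyData.raiseTo, KacMoodyData.raiseTo, add_assoc, ← add_smul]
  congr 2
  rcases le_total (runMin (K.H i g) 0 (clamp01 t)) x with h | h
  · rw [max_eq_right h, max_eq_right (by linarith), max_eq_right (by linarith),
      max_eq_right (by linarith)]
    ring
  · rw [max_eq_left h, max_eq_left (b := x - _) (by linarith), zero_add]

lemma lowerTo_lowerTo (hg : K.IntegralPath i m g) {y : ℝ} (hxy : x ≤ y) (hx : x ≤ K.H i g 1) :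
    K.lowerTo i (y - 2 * max 0 (x - runMin (K.H i g) 0 1)) (K.lowerTo i x g) =
      K.lowerTo i y g := by
  have key : ∀ j : ℝ, max 0 (x - j) + max 0 (y - max j x) = max 0 (y - j) := by
    intro j
    rcases le_total j x with h | h
    · rw [max_eq_right h, max_eq_right (by linarith), max_eq_right (by linarith),
        max_eq_right (by linarith)]
      ring
    · rw [max_eq_left h, max_eq_left (b := x - _) (by linarith), zero_add]
  ext t
  rw [KacMoodyData.lowerTo, hg.runMin_lowerTo hx (clamp01_nonneg t) (clamp01_le_one t),
    hg.runMin_lowerTo hx le_rfl zero_le_one, sub_sub_sub_cancel_right,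
    sub_sub_sub_cancel_right, KacMoodyData.lowerTo, KacMoodyData.lowerTo,
    ← key (runMin (K.H i g) (clamp01 t) 1), ← key (runMin (K.H i g) 0 1)]
  module

lemma raiseTo_runMin (hg : K.IntegralPath i m g) :
    K.raiseTo i (runMin (K.H i g) 0 1) g = g := by
  ext t
  rw [KacMoodyData.raiseTo, max_eq_left]
  · simp
  · linarith [runMin_anti_right hg.cont (clamp01_nonneg t) (clamp01_le_one t)]

lemma lowerTo_runMin (hg : K.IntegralPath i m g) :
    K.lowerTo i (runMin (K.H i g) 0 1) g = g := by
  ext t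
  rw [KacMoodyData.lowerTo, max_eq_left]
  · simp
  · linarith [runMin_mono_left hg.cont (clamp01_nonneg t) (clamp01_le_one t)]

lemma tensEIter_subdiv (hg : K.IntegralPath i m g) (hm : 1 ≤ m) (n : ℕ)
    (hn : runMin (K.H i g) 0 1 + n ≤ 0) :
    K.tensEIter i n (subdiv m g) =
      some (subdiv m (K.raiseTo i (runMin (K.H i g) 0 1 + n) g)) := by
  induction n with
  | zero => simp [tensEIter, hg.raiseTo_runMin]
  | succ n ih =>
    push_cast at hn ⊢
    have hg' := hg.raiseTo ((hg.runMin_int hm).add (IsInt.natCast n)) (by linarith)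
    have ih := ih (by linarith)
    rw [tensEIter] at ih ⊢
    rw [Function.iterate_succ_apply', ih, Option.bind_some, hg'.tensE_subdiv hm,
      hg.runMin_raiseTo (by linarith) zero_le_one le_rfl,
      max_eq_right (by linarith [n.cast_nonneg (α := ℝ)]), if_neg (by intro e; linarith),
      hg.raiseTo_raiseTo (by linarith) (by linarith), add_assoc]

lemma tensFIter_subdiv (hg : K.IntegralPath i m g) (hm : 1 ≤ m) (n : ℕ)
    (hn : runMin (K.H i g) 0 1 + n ≤ K.H i g 1) :
    K.tensFIter i n (subdiv m g) =
      some (subdiv m (K.lowerTo i (runMin (K.H i g) 0 1 + n) g)) := by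
  induction n with
  | zero => simp [tensFIter, hg.lowerTo_runMin]
  | succ n ih =>
    push_cast at hn ⊢
    have hx : runMin (K.H i g) 0 1 + n ≤ K.H i g 1 := by linarith
    have hg' := hg.lowerTo hm ((hg.runMin_int hm).add (IsInt.natCast n))
    have ih := ih hx
    rw [tensFIter] at ih ⊢
    rw [Function.iterate_succ_apply', ih, Option.bind_some, hg'.tensF_subdiv hm,
      hg.runMin_lowerTo hx le_rfl zero_le_one, H_one_lowerTo hx,
      max_eq_right (a := runMin _ _ _) (by linarith [n.cast_nonneg (α := ℝ)]),
      if_neg (by intro e; linarith),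
      ← hg.lowerTo_lowerTo (y := runMin (K.H i g) 0 1 + (n + 1)) (by linarith) hx]
    congr 3
    ring

end IntegralPath

lemma H_dilate (f : ℝ → V) : K.H i (dilate m f) = fun t => (m : ℝ) * K.H i f t := by
  ext t; simp [H, dilate]

lemma IntegralPath.runMin_dilate {f : ℝ → V} (hf : K.IntegralPath i 1 f) {a b : ℝ}
    (hab : a ≤ b) :
    runMin (K.H i (dilate m f)) a b = m * runMin (K.H i f) a b := by
  rw [H_dilate, runMin_const_mul hf.cont hab m.cast_nonneg]

lemma IntegralPath.dilate {f : ℝ → V} (hf : K.IntegralPath i 1 f)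
    (hnodes : ∀ k ≤ m, IsInt (m * K.H i f ((k : ℝ) / m))) :
    K.IntegralPath i m (dilate m f) where
  cont := by
    rw [H_dilate]
    have := hf.cont
    fun_prop
  zero := by simp [LSPaper.dilate, hf.zero]
  clamp t := by simp only [LSPaper.dilate]; rw [hf.clamp]
  intMin := by rw [H_dilate]; exact hf.intMin.const_mul hf.cont m
  int k hk := by rw [H_dilate]; exact hnodes k hk

lemma dilate_raiseTo {f : ℝ → V} (hf : K.IntegralPath i 1 f) :
    LSPaper.dilate m (K.raiseTo i x f) = K.raiseTo i (m * x) (LSPaper.dilate m f) := by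
  ext t
  simp only [LSPaper.dilate, raiseTo]
  rw [hf.runMin_dilate (clamp01_nonneg t), ← mul_sub, ← mul_zero (m : ℝ),
    ← mul_max_of_nonneg _ _ m.cast_nonneg, smul_add, smul_smul]
  simp

lemma dilate_lowerTo {f : ℝ → V} (hf : K.IntegralPath i 1 f) :
    LSPaper.dilate m (K.lowerTo i x f) = K.lowerTo i (m * x) (LSPaper.dilate m f) := by
  ext t
  simp only [LSPaper.dilate, lowerTo]
  rw [hf.runMin_dilate (clamp01_le_one t), hf.runMin_dilate zero_le_one, ← mul_sub, ← mul_sub,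
    ← mul_zero (m : ℝ), ← mul_max_of_nonneg _ _ m.cast_nonneg,
    ← mul_max_of_nonneg _ _ m.cast_nonneg, ← mul_sub, smul_add, smul_smul]
  simp

namespace IntegralPath

variable {f : ℝ → V}

lemma tensEIter_sigmaMap (hf : K.IntegralPath i 1 f) (hm : 1 ≤ m)
    (hnodes : ∀ k ≤ m, IsInt (m * K.H i f ((k : ℝ) / m))) :
    K.tensEIter i m (SigmaMap m f) = (K.eop i f).map (SigmaMap m) := by
  have hg := hf.dilate hnodes
  have hm0 : (0 : ℝ) < m := by exact_mod_cast hm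
  rw [hf.eop_eq le_rfl, SigmaMap]
  split_ifs with h
  · obtain ⟨n, rfl⟩ := Nat.exists_eq_add_of_le' hm
    rw [tensEIter, Function.iterate_succ_apply, Option.bind_some, hg.tensE_subdiv hm,
      hf.runMin_dilate zero_le_one, h, if_pos (by simp)]
    exact iterate_bind_none _ n
  · have h1 := (hf.runMin_int le_rfl).add_one_le IsInt.zero (lt_of_le_of_ne hf.runMin_nonpos h)
    rw [hg.tensEIter_subdiv hm, Option.map_some, SigmaMap, dilate_raiseTo hf,
      hf.runMin_dilate zero_le_one, mul_add, mul_one]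
    rw [hf.runMin_dilate zero_le_one]
    nlinarith

lemma tensFIter_sigmaMap (hf : K.IntegralPath i 1 f) (hm : 1 ≤ m)
    (hnodes : ∀ k ≤ m, IsInt (m * K.H i f ((k : ℝ) / m))) :
    K.tensFIter i m (SigmaMap m f) = (K.fop i f).map (SigmaMap m) := by
  have hg := hf.dilate hnodes
  have hm0 : (0 : ℝ) < m := by exact_mod_cast hm
  rw [hf.fop_eq le_rfl, SigmaMap]
  split_ifs with h
  · obtain ⟨n, rfl⟩ := Nat.exists_eq_add_of_le' hm
    rw [tensFIter, Function.iterate_succ_apply, Option.bind_some, hg.tensF_subdiv hm,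
      hf.runMin_dilate zero_le_one, h, if_pos (by rw [H_dilate])]
    exact iterate_bind_none _ n
  · have h1 := (hf.runMin_int le_rfl).add_one_le (hf.H_one le_rfl)
      (lt_of_le_of_ne hf.runMin_le_one h)
    rw [hg.tensFIter_subdiv hm, Option.map_some, SigmaMap, dilate_lowerTo hf,
      hf.runMin_dilate zero_le_one, mul_add, mul_one]
    rw [hf.runMin_dilate zero_le_one, H_dilate]
    simp only
    nlinarith

lemma tensEps_sigmaMap (hf : K.IntegralPath i 1 f) (hm : 1 ≤ m)
    (hnodes : ∀ k ≤ m, IsInt (m * K.H i f ((k : ℝ) / m))) :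
    K.tensEps i (SigmaMap m f) = (m : ℤ) * (K.epsilon i f : ℤ) := by
  have hg := hf.dilate hnodes
  obtain ⟨n, rfl⟩ := Nat.exists_eq_add_of_le' hm
  rw [SigmaMap, subdiv_eq_segments, ← Int.cast_inj (α := ℝ),
    hg.tensEps_segments n (by omega), Nat.cast_zero, zero_div, hg.H_zero,
    hf.runMin_dilate zero_le_one, Int.cast_mul, Int.cast_natCast, Int.cast_natCast,
    hf.epsilon_eq le_rfl]
  ring

lemma tensPhi_sigmaMap (hf : K.IntegralPath i 1 f) (hm : 1 ≤ m)
    (hnodes : ∀ k ≤ m, IsInt (m * K.H i f ((k : ℝ) / m))) :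
    K.tensPhi i (SigmaMap m f) = (m : ℤ) * (K.phi i f : ℤ) := by
  have hg := hf.dilate hnodes
  obtain ⟨n, rfl⟩ := Nat.exists_eq_add_of_le' hm
  rw [SigmaMap, subdiv_eq_segments, ← Int.cast_inj (α := ℝ),
    hg.tensPhi_segments n (by omega), Nat.cast_zero, zero_div,
    hf.runMin_dilate zero_le_one, Int.cast_mul, Int.cast_natCast, Int.cast_natCast,
    hf.phi_eq le_rfl, H_dilate]
  ring

end IntegralPath

end KacMoodyData

end LSPaper

namespace LSPaper
namespace KacMoodyData

variable {I V : Type*} [Fintype I] [DecidableEq I] [AddCommGroup V] [Module ℝ V]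
variable {K : KacMoodyData I V}

lemma α_mem_Qplus (i : I) : K.α i ∈ K.Qplus :=
  ⟨Pi.single i 1, by simp [Pi.single_apply]⟩

lemma add_mem_Qplus {u v : V} (hu : u ∈ K.Qplus) (hv : v ∈ K.Qplus) : u + v ∈ K.Qplus := by
  obtain ⟨c, rfl⟩ := hu
  obtain ⟨d, rfl⟩ := hv
  exact ⟨c + d, by simp [add_smul, Finset.sum_add_distrib]⟩

lemma natCast_smul_mem_Qplus {u : V} (hu : u ∈ K.Qplus) (n : ℕ) : (n : ℝ) • u ∈ K.Qplus := by
  obtain ⟨c, rfl⟩ := hu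
  exact ⟨n • c, by simp [Finset.smul_sum, mul_smul]⟩

lemma intCast_smul_mem_Qplus {u : V} (hu : u ∈ K.Qplus) {n : ℤ} (hn : 0 ≤ n) :
    (n : ℝ) • u ∈ K.Qplus := by
  lift n to ℕ using hn
  exact natCast_smul_mem_Qplus hu n

/-- `w` is a product of `n` simple reflections. -/
def IsWord (K : KacMoodyData I V) (w : V ≃ₗ[ℝ] V) (n : ℕ) : Prop :=
  ∃ l : List I, l.length = n ∧ (l.map K.refl).prod = w

lemma refl_mul_refl (i : I) : K.refl i * K.refl i = 1 := by
  ext x; exact K.refl_refl i x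

lemma IsWord.mul {v w : V ≃ₗ[ℝ] V} {a b : ℕ} (hv : K.IsWord v a) (hw : K.IsWord w b) :
    K.IsWord (v * w) (a + b) := by
  obtain ⟨l, rfl, rfl⟩ := hv
  obtain ⟨l', rfl, rfl⟩ := hw
  exact ⟨l ++ l', by simp⟩

lemma isWord_one : K.IsWord 1 0 := ⟨[], by simp⟩

lemma isWord_refl (i : I) : K.IsWord (K.refl i) 1 := ⟨[i], by simp⟩

lemma exists_isWord {w : V ≃ₗ[ℝ] V} (hw : w ∈ K.weylGroup) : ∃ n, K.IsWord w n := by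
  induction hw using Subgroup.closure_induction with
  | mem x hx => obtain ⟨i, rfl⟩ := hx; exact ⟨1, isWord_refl i⟩
  | one => exact ⟨0, isWord_one⟩
  | mul x y _ _ hx hy =>
    obtain ⟨a, ha⟩ := hx
    obtain ⟨b, hb⟩ := hy
    exact ⟨a + b, ha.mul hb⟩
  | inv x _ hx =>
    obtain ⟨_, l, rfl, rfl⟩ := hx
    refine ⟨l.length, l.reverse, by simp, ?_⟩
    rw [List.prod_inv_reverse, List.map_reverse, List.map_map]
    congr 2

/-- The alternating product `⋯ r_t r_s r_t` with `n` factors. -/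
def altProd (K : KacMoodyData I V) (s t : I) : ℕ → (V ≃ₗ[ℝ] V)
  | 0 => 1
  | n + 1 => (if Even n then K.refl t else K.refl s) * altProd K s t n

lemma isWord_altProd (s t : I) (n : ℕ) : K.IsWord (K.altProd s t n) n := by
  induction n with
  | zero => exact isWord_one
  | succ n ih =>
    rw [altProd, add_comm n 1]
    refine IsWord.mul ?_ ih
    split_ifs <;> exact isWord_refl _

lemma refl_comb_left {s t : I} (p q : ℝ) : K.refl s (p • K.α s + q • K.α t) =
    (-K.a s t * q - p) • K.α s + q • K.α t := by
  rw [refl_apply, map_add, map_smul, map_smul, coroot_α_self, K.cartanPairing]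
  module

lemma refl_comb_right {s t : I} (p q : ℝ) : K.refl t (p • K.α s + q • K.α t) =
    p • K.α s + (-K.a t s * p - q) • K.α t := by
  rw [add_comm, refl_comb_left, add_comm]

/-- In infinite rank-two type all the alternating products preserve positivity. -/
lemma altProd_root_of_four_le {s t : I} (hst : s ≠ t) (h4 : 4 ≤ K.a s t * K.a t s) (n : ℕ) :
    ∃ p q : ℤ, 0 ≤ p ∧ 0 ≤ q ∧
      K.altProd s t n (K.α s) = (p : ℝ) • K.α s + (q : ℝ) • K.α t ∧
      if Even n then 2 * q ≤ -K.a t s * p else 2 * p ≤ -K.a s t * q := by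
  have hx := K.offDiag s t hst
  have hy := K.offDiag t s hst.symm
  induction n with
  | zero => exact ⟨1, 0, by simp, le_rfl, by simp [altProd], by simpa using hy⟩
  | succ n ih =>
    obtain ⟨p, q, hp, hq, e, h⟩ := ih
    by_cases hn : Even n
    · rw [if_pos hn] at h
      refine ⟨p, -K.a t s * p - q, hp, by linarith, ?_, ?_⟩
      · rw [altProd, if_pos hn, LinearEquiv.mul_apply, e, refl_comb_right]
        push_cast; rfl
      · rw [if_neg (by simpa [Nat.even_add_one] using hn)]
        nlinarith
    · rw [if_neg hn] at h
      refine ⟨-K.a s t * q - p, q, by linarith, hq, ?_, ?_⟩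
      · rw [altProd, if_neg hn, LinearEquiv.mul_apply, e, refl_comb_left]
        push_cast; rfl
      · rw [if_pos (by simpa [Nat.even_add_one] using hn)]
        nlinarith

lemma isWord_altProd_mul_of_le {s t : I} {n k : ℕ} {w : V ≃ₗ[ℝ] V} {l : ℕ} (hl : l < n)
    (h : K.IsWord (K.altProd s t n * w) l) (hnk : n ≤ k) :
    ∃ l < k, K.IsWord (K.altProd s t k * w) l := by
  induction k, hnk using Nat.le_induction with
  | base => exact ⟨l, hl, h⟩
  | succ k _ ih =>
    obtain ⟨l', h1, h2⟩ := ih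
    refine ⟨1 + l', by omega, ?_⟩
    rw [altProd, mul_assoc]
    refine IsWord.mul ?_ h2
    split_ifs <;> exact isWord_refl _

set_option linter.unusedSimpArgs false in
lemma altProd_root_of_lt_four {s t : I} (hst : s ≠ t) (h4 : K.a s t * K.a t s < 4) (k : ℕ) :
    (∃ p q : ℤ, 0 ≤ p ∧ 0 ≤ q ∧
      K.altProd s t k (K.α s) = (p : ℝ) • K.α s + (q : ℝ) • K.α t) ∨
    ∃ l < k, K.IsWord (K.altProd s t k * K.refl s) l := by
  have hx := K.offDiag s t hst
  have hy := K.offDiag t s hst.symm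
  have hz := K.zeroIff s t
  have hss := K.coroot_α_self s
  have htt := K.coroot_α_self t
  have hst' := K.cartanPairing s t
  have hts' := K.cartanPairing t s
  have key : (K.a s t = 0 ∧ K.a t s = 0) ∨ (K.a s t = -1 ∧ K.a t s = -1) ∨
      (K.a s t = -1 ∧ K.a t s = -2) ∨ (K.a s t = -2 ∧ K.a t s = -1) ∨
      (K.a s t = -1 ∧ K.a t s = -3) ∨ (K.a s t = -3 ∧ K.a t s = -1) := by
    rcases hx.eq_or_lt with h | h
    · exact Or.inl ⟨h, hz.1 h⟩
    · have h' : K.a t s < 0 := lt_of_le_of_ne hy fun e => h.ne (hz.2 e)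
      have h1 : -4 < K.a s t := by nlinarith
      have h2 : -4 < K.a t s := by nlinarith
      generalize K.a s t = x at *
      generalize K.a t s = y at *
      interval_cases x <;> interval_cases y <;> simp_all
  have word : ∀ n l : ℕ, l < n → ∀ L : List I, L.length = l →
      (∀ x, (L.map K.refl).prod x = K.altProd s t n (K.refl s x)) → n ≤ k →
      ∃ l < k, K.IsWord (K.altProd s t k * K.refl s) l := fun n l hl L hL h hnk =>
    isWord_altProd_mul_of_le hl ⟨L, hL, by ext x; exact h x⟩ hnk
  have root : ∀ j, (∃ p q : ℕ, K.altProd s t j (K.α s) = (p : ℝ) • K.α s + (q : ℝ) • K.α t) →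
      ∃ p q : ℤ, 0 ≤ p ∧ 0 ≤ q ∧
        K.altProd s t j (K.α s) = (p : ℝ) • K.α s + (q : ℝ) • K.α t := fun j ⟨p, q, h⟩ =>
    ⟨p, q, by positivity, by positivity, by simpa using h⟩
  rcases key with ⟨h1, h2⟩ | ⟨h1, h2⟩ | ⟨h1, h2⟩ | ⟨h1, h2⟩ | ⟨h1, h2⟩ | ⟨h1, h2⟩ <;>
    rw [h1] at hst' <;> rw [h2] at hts' <;> push_cast at hst' hts'
  · by_cases hk : 2 ≤ k
    · refine Or.inr (word 2 1 (by omega) [t] rfl (fun x => ?_) hk)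
      simp [altProd, Nat.even_iff, refl_apply, hss, htt, hst', hts']
      module
    · refine Or.inl (root k ?_)
      interval_cases k
      · exact ⟨1, 0, by simp [altProd, Nat.even_iff, refl_apply, hss, htt, hst', hts']⟩
      · exact ⟨1, 0, by simp [altProd, Nat.even_iff, refl_apply, hss, htt, hst', hts']⟩
  · by_cases hk : 3 ≤ k
    · refine Or.inr (word 3 2 (by omega) [s, t] rfl (fun x => ?_) hk)
      simp [altProd, Nat.even_iff, refl_apply, hss, htt, hst', hts']
      module
    · refine Or.inl (root k ?_)
      interval_cases k
      · exact ⟨1, 0, by simp [altProd, Nat.even_iff, refl_apply, hss, htt, hst', hts']⟩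
      · exact ⟨1, 1, by simp [altProd, Nat.even_iff, refl_apply, hss, htt, hst', hts']⟩
      · exact ⟨0, 1, by simp [altProd, Nat.even_iff, refl_apply, hss, htt, hst', hts']; module⟩
  · by_cases hk : 4 ≤ k
    · refine Or.inr (word 4 3 (by omega) [t, s, t] rfl (fun x => ?_) hk)
      simp [altProd, Nat.even_iff, refl_apply, hss, htt, hst', hts']
      module
    · refine Or.inl (root k ?_)
      interval_cases k
      · exact ⟨1, 0, by simp [altProd, Nat.even_iff, refl_apply, hss, htt, hst', hts']⟩
      · exact ⟨1, 2, by simp [altProd, Nat.even_iff, refl_apply, hss, htt, hst', hts']⟩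
      · exact ⟨1, 2, by simp [altProd, Nat.even_iff, refl_apply, hss, htt, hst', hts']⟩
      · exact ⟨1, 0, by simp [altProd, Nat.even_iff, refl_apply, hss, htt, hst', hts']; module⟩
  · by_cases hk : 4 ≤ k
    · refine Or.inr (word 4 3 (by omega) [t, s, t] rfl (fun x => ?_) hk)
      simp [altProd, Nat.even_iff, refl_apply, hss, htt, hst', hts']
      module
    · refine Or.inl (root k ?_)
      interval_cases k
      · exact ⟨1, 0, by simp [altProd, Nat.even_iff, refl_apply, hss, htt, hst', hts']⟩
      · exact ⟨1, 1, by simp [altProd, Nat.even_iff, refl_apply, hss, htt, hst', hts']⟩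
      · exact ⟨1, 1, by simp [altProd, Nat.even_iff, refl_apply, hss, htt, hst', hts']⟩
      · exact ⟨1, 0, by simp [altProd, Nat.even_iff, refl_apply, hss, htt, hst', hts']; module⟩
  · by_cases hk : 6 ≤ k
    · refine Or.inr (word 6 5 (by omega) [t, s, t, s, t] rfl (fun x => ?_) hk)
      simp [altProd, Nat.even_iff, refl_apply, hss, htt, hst', hts']
      module
    · refine Or.inl (root k ?_)
      interval_cases k
      · exact ⟨1, 0, by simp [altProd, Nat.even_iff, refl_apply, hss, htt, hst', hts']⟩
      · exact ⟨1, 3, by simp [altProd, Nat.even_iff, refl_apply, hss, htt, hst', hts']⟩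
      · exact ⟨2, 3, by simp [altProd, Nat.even_iff, refl_apply, hss, htt, hst', hts']; module⟩
      · exact ⟨2, 3, by simp [altProd, Nat.even_iff, refl_apply, hss, htt, hst', hts']; module⟩
      · exact ⟨1, 3, by simp [altProd, Nat.even_iff, refl_apply, hss, htt, hst', hts']; module⟩
      · exact ⟨1, 0, by simp [altProd, Nat.even_iff, refl_apply, hss, htt, hst', hts']; module⟩
  · by_cases hk : 6 ≤ k
    · refine Or.inr (word 6 5 (by omega) [t, s, t, s, t] rfl (fun x => ?_) hk)
      simp [altProd, Nat.even_iff, refl_apply, hss, htt, hst', hts']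
      module
    · refine Or.inl (root k ?_)
      interval_cases k
      · exact ⟨1, 0, by simp [altProd, Nat.even_iff, refl_apply, hss, htt, hst', hts']⟩
      · exact ⟨1, 1, by simp [altProd, Nat.even_iff, refl_apply, hss, htt, hst', hts']⟩
      · exact ⟨2, 1, by simp [altProd, Nat.even_iff, refl_apply, hss, htt, hst', hts']; module⟩
      · exact ⟨2, 1, by simp [altProd, Nat.even_iff, refl_apply, hss, htt, hst', hts']; module⟩
      · exact ⟨1, 1, by simp [altProd, Nat.even_iff, refl_apply, hss, htt, hst', hts']; module⟩
      · exact ⟨1, 0, by simp [altProd, Nat.even_iff, refl_apply, hss, htt, hst', hts']; module⟩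

lemma altProd_root {s t : I} (hst : s ≠ t) (k : ℕ) :
    (∃ p q : ℤ, 0 ≤ p ∧ 0 ≤ q ∧
      K.altProd s t k (K.α s) = (p : ℝ) • K.α s + (q : ℝ) • K.α t) ∨
    ∃ l < k, K.IsWord (K.altProd s t k * K.refl s) l := by
  rcases le_or_gt 4 (K.a s t * K.a t s) with h | h
  · obtain ⟨p, q, hp, hq, e, -⟩ := altProd_root_of_four_le hst h k
    exact Or.inl ⟨p, q, hp, hq, e⟩
  · exact altProd_root_of_lt_four hst h k

/-- If right multiplication by `r_s` does not shorten `w`, then `w α_s` is positive. -/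
lemma root_mem_Qplus_of_length {n : ℕ} {w : V ≃ₗ[ℝ] V} {s : I} (hw : K.IsWord w n)
    (hmin : ∀ k, K.IsWord w k → n ≤ k) (hs : ∀ k, K.IsWord (w * K.refl s) k → n ≤ k) :
    w (K.α s) ∈ K.Qplus := by
  induction n using Nat.strong_induction_on generalizing w s with
  | _ n ih =>
  obtain ⟨L, rfl, hL⟩ := hw
  rcases L.eq_nil_or_concat with rfl | ⟨L', t, rfl⟩
  · simp only [List.map_nil, List.prod_nil] at hL
    subst hL
    exact α_mem_Qplus s
  simp only [List.concat_eq_append, List.length_append, List.length_cons, List.length_nil,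
    zero_add, List.map_append, List.map_cons, List.map_nil, List.prod_append,
    List.prod_singleton] at *
  set n := L'.length
  have hv1 : K.IsWord (L'.map K.refl).prod n := ⟨L', rfl, rfl⟩
  have hst : s ≠ t := by
    rintro rfl
    have := hs n (by rwa [← hL, mul_assoc, refl_mul_refl, mul_one])
    omega
  let P : ℕ → Prop := fun k => ∃ v, w = v * K.altProd s t k ∧ K.IsWord v (n + 1 - k)
  have hP1 : P 1 := ⟨_, by rw [← hL]; simp [altProd], hv1⟩
  set k := Nat.findGreatest P (n + 1) with hk
  have hPk : P k := Nat.findGreatest_spec (by omega) hP1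
  have hk1 : 1 ≤ k := Nat.le_findGreatest (by omega) hP1
  have hkn : k ≤ n + 1 := Nat.findGreatest_le _
  obtain ⟨v, e, hv⟩ := hPk
  obtain ⟨k', hk'⟩ := Nat.exists_eq_add_of_le' hk1
  have next : ∀ j, K.IsWord (v * if Even k then K.refl t else K.refl s) j → n + 1 - k ≤ j := by
    intro j hj
    by_contra! hlt
    have e' : w = (v * if Even k then K.refl t else K.refl s) * K.altProd s t (k + 1) := by
      rw [altProd, e, mul_assoc, ← mul_assoc (ite _ _ _)]
      split_ifs <;> rw [refl_mul_refl, one_mul]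
    have hj1 := hmin _ (e' ▸ hj.mul (isWord_altProd s t (k + 1)))
    have := Nat.le_findGreatest (P := P) (show k + 1 ≤ n + 1 by omega)
      ⟨_, e', by rwa [show n + 1 - (k + 1) = j by omega]⟩
    omega
  have prev : ∀ j, K.IsWord (v * if Even k then K.refl s else K.refl t) j → n + 1 - k ≤ j := by
    intro j hj
    have e' : w = (v * if Even k then K.refl s else K.refl t) * K.altProd s t k' := by
      rw [e, hk', altProd, mul_assoc]
      simp only [Nat.even_add_one]
      split_ifs <;> simp_all
    have hj1 := hmin _ (e' ▸ hj.mul (isWord_altProd s t k'))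
    omega
  have hvmin : ∀ j, K.IsWord v j → n + 1 - k ≤ j := fun j hj => by
    have := hmin _ (e ▸ hj.mul (isWord_altProd s t k))
    omega
  have hvs : v (K.α s) ∈ K.Qplus := ih _ (by omega) hv hvmin fun j hj => by
    by_cases h : Even k
    · exact prev j (by rwa [if_pos h])
    · exact next j (by rwa [if_neg h])
  have hvt : v (K.α t) ∈ K.Qplus := ih _ (by omega) hv hvmin fun j hj => by
    by_cases h : Even k
    · exact next j (by rwa [if_pos h])
    · exact prev j (by rwa [if_neg h])
  rcases altProd_root (K := K) hst k with ⟨p, q, hp, hq, h⟩ | ⟨l, hl, h⟩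
  · rw [e, LinearEquiv.mul_apply, h, map_add, map_smul, map_smul]
    exact add_mem_Qplus (intCast_smul_mem_Qplus hvs hp) (intCast_smul_mem_Qplus hvt hq)
  · have := hs _ (by rw [e, mul_assoc]; exact hv.mul h)
    omega

lemma refl_mem_weylGroup (i : I) : K.refl i ∈ K.weylGroup := Subgroup.subset_closure ⟨i, rfl⟩

/-- Every real root is positive or negative. -/
lemma root_mem_Qplus_or {w : V ≃ₗ[ℝ] V} (hw : w ∈ K.weylGroup) (s : I) :
    w (K.α s) ∈ K.Qplus ∨ -w (K.α s) ∈ K.Qplus := by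
  have h1 := exists_isWord hw
  have h2 := exists_isWord (K := K) (K.weylGroup.mul_mem hw (refl_mem_weylGroup s))
  rcases le_total (Nat.find h1) (Nat.find h2) with h | h
  · exact Or.inl (root_mem_Qplus_of_length (Nat.find_spec h1) (fun k hk => Nat.find_min' h1 hk)
      fun k hk => h.trans (Nat.find_min' h2 hk))
  · right
    have := root_mem_Qplus_of_length (K := K) (s := s) (Nat.find_spec h2)
      (fun k hk => Nat.find_min' h2 hk)
      fun k hk => h.trans (Nat.find_min' h1 (by rwa [mul_assoc, refl_mul_refl, mul_one] at hk))
    rwa [LinearEquiv.mul_apply, refl_apply, coroot_α_self, two_smul, sub_add_cancel_left,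
      map_neg] at this

/-- A simple reflection preserves positivity of the positive real roots other than multiples
of its own root. -/
lemma refl_root_mem_Qplus {w : V ≃ₗ[ℝ] V} (hw : w ∈ K.weylGroup) {i j : I}
    (hp : w (K.α j) ∈ K.Qplus) :
    K.refl i (w (K.α j)) ∈ K.Qplus ∨ ∃ c : ℕ, w (K.α j) = (c : ℝ) • K.α i := by
  rcases root_mem_Qplus_or (K.weylGroup.mul_mem (refl_mem_weylGroup i) hw) j with h | h
  · exact Or.inl h
  right
  rw [LinearEquiv.mul_apply] at h
  obtain ⟨c, hc⟩ := hp
  obtain ⟨d, hd⟩ := h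
  refine ⟨c i, ?_⟩
  have hli := Fintype.linearIndependent_iff.1 K.rootsIndep
    (fun k => (c k : ℝ) + d k - if k = i then K.coroot i (w (K.α j)) else 0) (by
      simp only [sub_smul, add_smul, Finset.sum_sub_distrib, Finset.sum_add_distrib, ite_smul,
        zero_smul, Finset.sum_ite_eq', Finset.mem_univ, if_true]
      rw [← hc, ← hd, refl_apply]
      module)
  rw [hc]
  refine Finset.sum_eq_single i (fun k _ hk => ?_) (by simp)
  have := hli k
  rw [if_neg hk, sub_zero] at this
  have : c k + d k = 0 := by exact_mod_cast this
  rw [show c k = 0 by omega]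
  simp

end KacMoodyData
end LSPaper

namespace LSPaper
namespace KacMoodyData

variable {I V : Type*} [Fintype I] [DecidableEq I] [AddCommGroup V] [Module ℝ V]
variable {K : KacMoodyData I V}

lemma coeff_nonneg_of_mem_Qplus {c : I → ℝ} (h : ∑ i, c i • K.α i ∈ K.Qplus) (i : I) :
    0 ≤ c i := by
  obtain ⟨d, hd⟩ := h
  have := Fintype.linearIndependent_iff.1 K.rootsIndep (fun i => c i - d i) (by
    simp [sub_smul, hd]) i
  linarith [(d i).cast_nonneg (α := ℝ)]

/-- An element of the Weyl group preserving positivity of all simple roots is trivial. -/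
lemma eq_one_of_roots_mem_Qplus {u : V ≃ₗ[ℝ] V} (hu : u ∈ K.weylGroup)
    (h : ∀ k, u (K.α k) ∈ K.Qplus) : u = 1 := by
  have h1 := exists_isWord hu
  obtain ⟨L, hL, e⟩ := Nat.find_spec h1
  rcases L.eq_nil_or_concat with rfl | ⟨L', t, rfl⟩
  · simpa using e.symm
  exfalso
  simp only [List.concat_eq_append, List.length_append, List.length_cons, List.length_nil,
    zero_add, List.map_append, List.map_cons, List.map_nil, List.prod_append,
    List.prod_singleton] at hL e
  have e' : (L'.map K.refl).prod = u * K.refl t := by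
    rw [← e, mul_assoc, refl_mul_refl, mul_one]
  have hpos := root_mem_Qplus_of_length (K := K) (n := L'.length) (s := t) ⟨L', rfl, e'⟩
    (fun k hk => by
      have := Nat.find_min' h1 (by
        simpa [mul_assoc, refl_mul_refl] using hk.mul (isWord_refl t))
      omega)
    (fun k hk => by
      have := Nat.find_min' h1 (by simpa [mul_assoc, refl_mul_refl] using hk)
      omega)
  have ht := h t
  rw [LinearEquiv.mul_apply, refl_apply, coroot_α_self, two_smul, sub_add_cancel_left,
    map_neg] at hpos
  obtain ⟨c, hc⟩ := ht
  have hc0 : ∀ i, c i = 0 := fun i => by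
    have := coeff_nonneg_of_mem_Qplus (K := K) (c := fun i => -(c i : ℝ)) (by
      simpa [hc] using hpos) i
    have h0 : (c i : ℝ) ≤ 0 := by linarith
    exact Nat.le_zero.1 (by exact_mod_cast h0)
  have : u (K.α t) = 0 := by simp [hc, hc0]
  exact K.rootsIndep.ne_zero t (u.map_eq_zero_iff.1 this)

/-- A real root proportional to a simple root has a proportional coroot. -/
lemma coroot_eq_of_root_eq {w : V ≃ₗ[ℝ] V} (hw : w ∈ K.weylGroup) {i j : I} {c : ℝ}
    (h : w (K.α j) = c • K.α i) (x : V) : K.coroot i x = c * K.coroot j (w.symm x) := by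
  have hα : ∀ k, K.α k ≠ 0 := K.rootsIndep.ne_zero
  have hc : c ≠ 0 := by
    rintro rfl
    rw [zero_smul] at h
    exact hα j (w.map_eq_zero_iff.1 h)
  have conj : ∀ x, (w * K.refl j * w⁻¹) x = x - (c * K.coroot j (w.symm x)) • K.α i := by
    intro x
    change w (K.refl j (w.symm x)) = _
    rw [refl_apply, map_sub, map_smul, LinearEquiv.apply_symm_apply, h, smul_smul, mul_comm]
  have hsymm : w.symm (K.α i) = c⁻¹ • K.α j := by
    rw [LinearEquiv.symm_apply_eq, map_smul, h, smul_smul, inv_mul_cancel₀ hc, one_smul]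
  have hu : w * K.refl j * w⁻¹ * K.refl i ∈ K.weylGroup :=
    mul_mem (mul_mem (mul_mem hw (refl_mem_weylGroup j)) (inv_mem hw)) (refl_mem_weylGroup i)
  have hone := eq_one_of_roots_mem_Qplus hu fun k => by
    by_cases hk : k = i
    · subst hk
      rw [LinearEquiv.mul_apply, refl_apply, coroot_α_self, conj]
      simp only [map_sub, map_smul, hsymm, coroot_α_self, smul_eq_mul]
      have : c * (c⁻¹ * 2 - 2 * (c⁻¹ * 2)) = -2 := by field_simp; ring
      rw [this]
      convert α_mem_Qplus (K := K) k using 1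
      module
    · rcases root_mem_Qplus_or hu k with h | h
      · exact h
      exfalso
      obtain ⟨y, hy⟩ : ∃ y : ℝ, (w * K.refl j * w⁻¹ * K.refl i) (K.α k) =
          K.α k + y • K.α i := by
        rw [LinearEquiv.mul_apply, conj, refl_apply]
        exact ⟨-K.coroot i (K.α k) -
          c * K.coroot j (w.symm (K.α k - K.coroot i (K.α k) • K.α i)), by module⟩
      have := coeff_nonneg_of_mem_Qplus (K := K)
        (c := fun l => -(if l = k then 1 else 0) - if l = i then y else 0) (by
          convert h using 1
          rw [hy]
          simp only [sub_smul, neg_smul, ite_smul, one_smul, zero_smul,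
            Finset.sum_sub_distrib, Finset.sum_neg_distrib, Finset.sum_ite_eq',
            Finset.mem_univ, if_true]
          abel) k
      simp [hk] at this
      linarith
  have e := congrArg (fun u : V ≃ₗ[ℝ] V => u (K.refl i x)) hone
  simp only [LinearEquiv.mul_apply (f := w * K.refl j * w⁻¹), refl_refl, conj] at e
  change _ = K.refl i x at e
  rw [refl_apply, sub_right_inj] at e
  exact (smul_left_injective ℝ (hα i) e).symm

lemma weylGroup_mem_P {w : V ≃ₗ[ℝ] V} (hw : w ∈ K.weylGroup) : ∀ v ∈ K.P, w v ∈ K.P := by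
  obtain ⟨_, L, -, rfl⟩ := exists_isWord hw
  induction L with
  | nil => intro v hv; simpa using hv
  | cons i L ih =>
    intro v hv
    have hL : (L.map K.refl).prod ∈ K.weylGroup :=
      Subgroup.list_prod_mem _ (by simpa using fun i _ => refl_mem_weylGroup i)
    obtain ⟨n, hn⟩ := K.pairingInt i _ (ih hL v hv)
    rw [List.map_cons, List.prod_cons, LinearEquiv.mul_apply, refl_apply, hn,
      Int.cast_smul_eq_zsmul]
    exact sub_mem (ih hL v hv) (zsmul_mem (K.rootMem i) n)

lemma not_chainLen_of_dist_eq_one {ν ν' : V} (h : K.dist ν ν' = 1) {p : ℕ} (hp : 1 < p) :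
    ¬ K.chainLen p ν ν' := by
  intro hc
  by_cases hb : BddAbove {p | K.chainLen p ν ν'}
  · have := le_csSup hb hc
    rw [dist] at h
    omega
  · rw [dist, Nat.sSup_of_not_bddAbove hb] at h
    omega

/-- A cover in a Weyl group orbit across the `α_i`-wall is the reflection `r_i`. -/
lemma root_eq_of_dist_eq_one {ξ : V} {w : V ≃ₗ[ℝ] V} {i j : I} (hw : w ∈ K.weylGroup)
    (hpos : w (K.α j) ∈ K.Qplus) (hneg : K.coroot j (w.symm ξ) < 0)
    (hd : K.dist ξ (w (K.refl j (w.symm ξ))) = 1) (h1 : K.coroot i ξ < 0)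
    (h2 : 0 < K.coroot i (w (K.refl j (w.symm ξ)))) : ∃ c : ℕ, w (K.α j) = (c : ℝ) • K.α i := by
  refine (refl_root_mem_Qplus (i := i) hw hpos).resolve_left fun hr => ?_
  set ξ' := w (K.refl j (w.symm ξ)) with hξ'
  refine not_chainLen_of_dist_eq_one hd (p := 3) (by norm_num)
    ⟨fun q => if q = 0 then ξ else if q = 1 then K.refl i ξ else
      if q = 2 then K.refl i ξ' else ξ', by simp, by simp, fun q hq => ?_⟩
  interval_cases q
  · exact ⟨1, one_mem _, i, α_mem_Qplus i, h1, rfl⟩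
  · have hs : (K.refl i * w).symm (K.refl i ξ) = w.symm ξ := by
      rw [LinearEquiv.symm_apply_eq, LinearEquiv.mul_apply, LinearEquiv.apply_symm_apply]
    exact ⟨K.refl i * w, mul_mem (refl_mem_weylGroup i) hw, j, hr, by simpa [hs] using hneg, by
      simp [hs, LinearEquiv.mul_apply, hξ']⟩
  · refine ⟨1, one_mem _, i, α_mem_Qplus i, ?_, ?_⟩
    · change K.coroot i (K.refl i ξ') < 0
      rw [coroot_refl]
      linarith
    · change _ = K.refl i (K.refl i ξ')
      rw [refl_refl]
      simp

lemma SigmaChain.isInt {σ : ℚ} (hσ : 0 < σ) {ν ν' : V} (h : K.SigmaChain σ ν ν') (i : I) :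
    IsInt ((σ : ℝ) * (K.coroot i ν - K.coroot i ν')) ∧
      (K.coroot i ν ≤ 0 → 0 ≤ K.coroot i ν' → IsInt ((σ : ℝ) * K.coroot i ν)) := by
  have hσ' : (0 : ℝ) < σ := by exact_mod_cast hσ
  obtain ⟨p, -, ξ, rfl, rfl, hξ⟩ := h
  have key : ∀ q ≤ p, IsInt ((σ : ℝ) * (K.coroot i (ξ 0) - K.coroot i (ξ q))) ∧
      (K.coroot i (ξ 0) ≤ 0 → IsInt ((σ : ℝ) * K.coroot i (ξ 0)) ∨ K.coroot i (ξ q) < 0) := by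
    intro q hq
    induction q with
    | zero =>
      refine ⟨by simpa using IsInt.zero, fun h => ?_⟩
      rcases h.eq_or_lt with h | h
      · exact Or.inl (by rw [h, mul_zero]; exact IsInt.zero)
      · exact Or.inr h
    | succ q ih =>
      obtain ⟨ih1, ih2⟩ := ih (by omega)
      obtain ⟨hd, w, hw, j, hpos, e, n, hn, hn'⟩ := hξ q (by omega)
      have hneg : K.coroot j (w.symm (ξ q)) < 0 := by
        have : (n : ℝ) < 0 := by exact_mod_cast hn
        nlinarith
      have e2 : K.coroot i (ξ (q + 1)) =
          K.coroot i (ξ q) - K.coroot j (w.symm (ξ q)) * K.coroot i (w (K.α j)) := by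
        rw [e, refl_apply, map_sub, map_smul, LinearEquiv.apply_symm_apply, map_sub, map_smul,
          smul_eq_mul]
      obtain ⟨b, hb⟩ := K.pairingInt i _ (weylGroup_mem_P hw _ (K.rootMem j))
      have h1 : IsInt ((σ : ℝ) * (K.coroot i (ξ 0) - K.coroot i (ξ (q + 1)))) := by
        convert ih1.add ((IsInt.intCast n).mul (IsInt.intCast b)) using 1
        rw [e2, ← hn', ← hb]
        ring
      refine ⟨h1, fun h0 => ?_⟩
      rcases ih2 h0 with h | h
      · exact Or.inl h
      rcases lt_trichotomy (K.coroot i (ξ (q + 1))) 0 with h' | h' | h'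
      · exact Or.inr h'
      · rw [h', sub_zero] at h1
        exact Or.inl h1
      · rw [e] at hd h'
        obtain ⟨c, hc⟩ := root_eq_of_dist_eq_one hw hpos hneg hd h h'
        left
        convert ih1.add ((IsInt.natCast c).mul (IsInt.intCast n)) using 1
        rw [← hn', coroot_eq_of_root_eq hw hc (ξ q)]
        ring
  refine ⟨(key p le_rfl).1, fun h0 h1 => ?_⟩
  exact ((key p le_rfl).2 h0).resolve_right (not_lt.2 h1)

end KacMoodyData
/-- The piecewise linear function with slopes `c k` between the consecutive nodes `a k`. -/
def piecewise (N : ℕ) (a c : ℕ → ℝ) : ℝ → ℝ := fun t =>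
  ∑ k ∈ Finset.range N, (min t (a (k + 1)) - min t (a k)) * c k

/-- The conditions on nodes `a k` and slopes `c k` satisfied by Lakshmibai–Seshadri paths. -/
structure IntegralSlopes (N : ℕ) (a c : ℕ → ℝ) : Prop where
  mono : Monotone a
  strict : ∀ k < N, a k < a (k + 1)
  zero : a 0 = 0
  one : a N = 1
  int : ∀ k < N, IsInt (c k)
  jump : ∀ k, k + 1 < N → IsInt (a (k + 1) * (c k - c (k + 1)))
  wall : ∀ k, k + 1 < N → c k ≤ 0 → 0 ≤ c (k + 1) → IsInt (a (k + 1) * c k)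

namespace IntegralSlopes

variable {N : ℕ} {a c : ℕ → ℝ}

lemma apply (h : IntegralSlopes N a c) {k : ℕ} (hk : k < N) {t : ℝ} (h1 : a k ≤ t)
    (h2 : t ≤ a (k + 1)) : piecewise N a c t =
      ∑ j ∈ Finset.range k, (a (j + 1) - a j) * c j + (t - a k) * c k := by
  rw [piecewise, ← Finset.sum_subset (Finset.range_subset_range.2 (Nat.succ_le_of_lt hk)),
    Finset.sum_range_succ, min_eq_left h2, min_eq_right h1]
  · congr 1
    refine Finset.sum_congr rfl fun j hj => ?_
    have hj := Finset.mem_range.1 hj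
    rw [min_eq_right ((h.mono (by omega)).trans h1), min_eq_right ((h.mono hj.le).trans h1)]
  · intro j _ hj
    have hj : k + 1 ≤ j := by simpa using hj
    rw [min_eq_left (h2.trans (h.mono hj)), min_eq_left (h2.trans (h.mono (by omega))),
      sub_self, zero_mul]

lemma isInt_sum (h : IntegralSlopes N a c) {k : ℕ} (hk : k < N) :
    IsInt (∑ j ∈ Finset.range k, (a (j + 1) - a j) * c j - a k * c k) := by
  induction k with
  | zero => simpa [h.zero] using IsInt.zero
  | succ k ih =>
    convert (ih (by omega)).add (h.jump k hk) using 1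
    rw [Finset.sum_range_succ]
    ring

lemma isInt_apply (h : IntegralSlopes N a c) {k : ℕ} (hk : k < N) {t : ℝ} (h1 : a k ≤ t)
    (h2 : t ≤ a (k + 1)) : IsInt (piecewise N a c t - t * c k) := by
  convert h.isInt_sum hk using 1
  rw [h.apply hk h1 h2]
  ring

lemma sub_apply (h : IntegralSlopes N a c) {k : ℕ} (hk : k < N) {t u : ℝ} (h1 : a k ≤ t)
    (h2 : t ≤ a (k + 1)) (h3 : a k ≤ u) (h4 : u ≤ a (k + 1)) :
    piecewise N a c t - piecewise N a c u = (t - u) * c k := by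
  rw [h.apply hk h1 h2, h.apply hk h3 h4]
  ring

lemma exists_lt (h : IntegralSlopes N a c) {t : ℝ} (h0 : 0 ≤ t) (h1 : t < 1) :
    ∃ k < N, a k ≤ t ∧ t < a (k + 1) := by
  set k := Nat.findGreatest (fun k => a k ≤ t) N with hk
  have hkt : a k ≤ t :=
    Nat.findGreatest_spec (P := fun k => a k ≤ t) (Nat.zero_le N) (h.zero.trans_le h0)
  have hkN : k < N := by
    refine lt_of_le_of_ne (Nat.findGreatest_le _) fun e => ?_
    rw [e, h.one] at hkt
    linarith
  refine ⟨k, hkN, hkt, not_le.1 fun h' => ?_⟩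
  have := Nat.le_findGreatest (P := fun k => a k ≤ t) hkN h'
  omega

lemma exists_le (h : IntegralSlopes N a c) {t : ℝ} (h0 : 0 ≤ t) (h1 : t ≤ 1) :
    ∃ k < N, a k ≤ t ∧ t ≤ a (k + 1) := by
  rcases h1.eq_or_lt with rfl | h1
  · obtain ⟨k, rfl⟩ : ∃ k, N = k + 1 := by
      cases N with
      | zero => exact absurd (h.zero.symm.trans h.one) zero_ne_one
      | succ k => exact ⟨k, rfl⟩
    exact ⟨k, by omega, (h.mono (by omega)).trans h.one.le, h.one.ge⟩
  · obtain ⟨k, hk, h2, h3⟩ := h.exists_lt h0 h1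
    exact ⟨k, hk, h2, h3.le⟩

lemma isInt_mul_apply (h : IntegralSlopes N a c) {m k : ℕ} (hk : k ≤ m) :
    IsInt (m * piecewise N a c ((k : ℝ) / m)) := by
  rcases m.eq_zero_or_pos with rfl | hm
  · simpa using IsInt.zero
  obtain ⟨j, hj, h1, h2⟩ := h.exists_le (t := (k : ℝ) / m) (by positivity)
    (div_le_one_of_le₀ (by exact_mod_cast hk) (by positivity))
  convert ((IsInt.natCast m).mul (h.isInt_apply hj h1 h2)).add
    ((IsInt.natCast k).mul (h.int j hj)) using 1
  field_simp
  ring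

lemma continuous_piecewise (N : ℕ) (a c : ℕ → ℝ) : Continuous (piecewise N a c) := by
  unfold piecewise
  fun_prop

lemma intMin (h : IntegralSlopes N a c) : IntMin (piecewise N a c) := by
  have hc := continuous_piecewise N a c
  intro x y hx hxy hy
  obtain ⟨t₀, h1₀, h2₀, e₀⟩ := exists_eq_runMin hc hxy
  have hcomp : IsCompact (Set.Icc x y ∩ {t | piecewise N a c t = runMin (piecewise N a c) x y}) :=
    isCompact_Icc.inter_right (isClosed_eq hc continuous_const)
  obtain ⟨u, ⟨⟨hxu, huy⟩, hu⟩, hmax⟩ := hcomp.exists_isGreatest ⟨t₀, ⟨h1₀, h2₀⟩, e₀⟩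
  have hu : piecewise N a c u = runMin (piecewise N a c) x y := hu
  have hle : ∀ t, x ≤ t → t ≤ y → piecewise N a c u ≤ piecewise N a c t := fun t h1 h2 => by
    rw [hu]
    exact runMin_le hc h1 h2
  rw [← hu]
  rcases hxu.eq_or_lt with rfl | hxu
  · exact Or.inr (Or.inl rfl)
  rcases huy.eq_or_lt with rfl | huy
  · exact Or.inr (Or.inr rfl)
  left
  obtain ⟨k, hk, h1, h2⟩ := h.exists_lt (hx.trans hxu.le) (huy.trans_le hy)
  have hck : 0 < c k := by
    set v := min y (a (k + 1))
    have huv : u < v := lt_min huy h2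
    have hvy : v ≤ y := min_le_left _ _
    have e := h.sub_apply hk (h1.trans huv.le) (min_le_right _ _) h1 h2.le
    have hlt : piecewise N a c u < piecewise N a c v := by
      refine lt_of_le_of_ne (hle v (by linarith) hvy) fun e => ?_
      exact absurd (hmax ⟨⟨by linarith, hvy⟩, by rw [Set.mem_ofPred_eq, ← e, hu]⟩) (not_le.2 huv)
    by_contra! hneg
    nlinarith
  have hua : u = a k := by
    refine le_antisymm (not_lt.1 fun hlt => ?_) h1
    set v := max x (a k)
    have hvu : v < u := max_lt hxu hlt
    have e := h.sub_apply hk (le_max_right _ _) (hvu.le.trans h2.le) h1 h2.le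
    have := hle v (le_max_left _ _) (by linarith)
    nlinarith
  subst hua
  obtain ⟨k, rfl⟩ : ∃ j, k = j + 1 := by
    cases k with
    | zero => rw [h.zero] at hxu; linarith
    | succ j => exact ⟨j, rfl⟩
  have hck' : c k ≤ 0 := by
    set v := max x (a k)
    have hs := h.strict k (by omega)
    have hvu : v < a (k + 1) := max_lt hxu hs
    have e := h.sub_apply (k := k) (by omega) (le_max_right _ _) hvu.le hs.le le_rfl
    have := hle v (le_max_left _ _) (by linarith)
    nlinarith
  have h3 := h.isInt_apply (k := k) (by omega) (h.strict k (by omega)).le le_rfl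
  convert h3.add (h.wall k hk hck' hck.le) using 1
  ring

end IntegralSlopes

namespace KacMoodyData

variable {I V : Type*} [Fintype I] [DecidableEq I] [AddCommGroup V] [Module ℝ V]
variable {K : KacMoodyData I V} {μ : V}

namespace LSData

/-- The nodes of a Lakshmibai–Seshadri path, extended by `1`. -/
def node (π : K.LSData μ) (k : ℕ) : ℝ := if h : k < π.s + 1 then (π.τ ⟨k, h⟩ : ℝ) else 1

/-- The slopes of `H_i` along a Lakshmibai–Seshadri path, extended by `0`. -/
def slope (π : K.LSData μ) (i : I) (k : ℕ) : ℝ :=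
  if h : k < π.s then K.coroot i (π.ν ⟨k, h⟩) else 0

lemma H_path (π : K.LSData μ) (i : I) :
    K.H i π.path = piecewise π.s π.node (π.slope i) := by
  ext t
  rw [piecewise, ← Fin.sum_univ_eq_sum_range
    (fun k => (min t (π.node (k + 1)) - min t (π.node k)) * π.slope i k)]
  simp only [H, path, map_sum, map_smul, smul_eq_mul]
  refine Finset.sum_congr rfl fun k _ => ?_
  rw [node, node, slope, dif_pos (by omega), dif_pos (by omega), dif_pos k.2]
  rfl

lemma tau_mem (π : K.LSData μ) (k : Fin (π.s + 1)) : (0 : ℝ) ≤ π.τ k ∧ (π.τ k : ℝ) ≤ 1 := by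
  have h0 := π.τ_mono.monotone (Fin.zero_le k)
  have h1 := π.τ_mono.monotone (Fin.le_last k)
  rw [π.τ_zero] at h0
  rw [π.τ_last] at h1
  exact ⟨by exact_mod_cast h0, by exact_mod_cast h1⟩

lemma integralSlopes (π : K.LSData μ) (hμ : μ ∈ K.P) (i : I) :
    IntegralSlopes π.s π.node (π.slope i) where
  mono := monotone_nat_of_le_succ fun k => by
    unfold node
    split_ifs
    · exact_mod_cast π.τ_mono.monotone (by simp)
    · exact (π.tau_mem _).2
    · omega
    · exact le_rfl
  strict k hk := by
    rw [node, node, dif_pos (by omega), dif_pos (by omega)]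
    exact_mod_cast π.τ_mono (by simp)
  zero := by
    rw [node, dif_pos (by omega)]
    exact_mod_cast π.τ_zero
  one := by
    rw [node, dif_pos (by omega)]
    exact_mod_cast π.τ_last
  int k hk := by
    rw [slope, dif_pos hk]
    obtain ⟨w, hw, e⟩ := π.mem ⟨k, hk⟩
    rw [e]
    exact K.pairingInt i _ (weylGroup_mem_P hw μ hμ)
  jump k hk := by
    rw [node, slope, slope, dif_pos (show k + 1 < π.s + 1 by omega),
      dif_pos (show k < π.s by omega), dif_pos hk]
    exact ((π.chainCond k hk).isInt (π.τ_zero ▸ π.τ_mono (by simp [Fin.lt_def])) i).1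
  wall k hk := by
    rw [node, slope, slope, dif_pos (show k + 1 < π.s + 1 by omega),
      dif_pos (show k < π.s by omega), dif_pos hk]
    exact ((π.chainCond k hk).isInt (π.τ_zero ▸ π.τ_mono (by simp [Fin.lt_def])) i).2

lemma path_zero (π : K.LSData μ) : π.path 0 = 0 := by
  refine Finset.sum_eq_zero fun k _ => ?_
  rw [min_eq_left (π.tau_mem _).1, min_eq_left (π.tau_mem _).1, sub_self, zero_smul]

lemma path_clamp (π : K.LSData μ) (t : ℝ) : π.path t = π.path (clamp01 t) := by
  rcases le_total t 0 with h | h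
  · rw [clamp01_of_nonpos h, path_zero]
    refine Finset.sum_eq_zero fun k _ => ?_
    rw [min_eq_left (h.trans (π.tau_mem _).1), min_eq_left (h.trans (π.tau_mem _).1), sub_self,
      zero_smul]
  rcases le_total t 1 with h' | h'
  · rw [clamp01_of_mem h h']
  · rw [clamp01_of_one_le h']
    refine Finset.sum_congr rfl fun k _ => ?_
    simp only [min_eq_right (π.tau_mem _).2, min_eq_right ((π.tau_mem _).2.trans h')]

lemma integralPath (π : K.LSData μ) (hμ : μ ∈ K.P) (i : I) : K.IntegralPath i 1 π.path where
  cont := by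
    rw [H_path]
    exact IntegralSlopes.continuous_piecewise _ _ _
  zero := π.path_zero
  clamp := π.path_clamp
  intMin := by
    rw [H_path]
    exact (π.integralSlopes hμ i).intMin
  int k hk := by
    rw [H_path]
    simpa using (π.integralSlopes hμ i).isInt_mul_apply hk

end LSData

end KacMoodyData
section sigmaMap

variable {V : Type*} [AddCommGroup V] [Module ℝ V]

lemma eq_of_sigmaMap_eq {m : ℕ} (hm : 1 ≤ m) {f g : ℝ → V} (h : SigmaMap m f = SigmaMap m g)
    (h0 : f 0 = g 0) {t : ℝ} (ht0 : 0 ≤ t) (ht1 : t ≤ 1) : f t = g t := by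
  have hm0 : (0 : ℝ) < m := by exact_mod_cast hm
  have hp : ∀ k < m, ∀ s, 0 ≤ s → s ≤ 1 → f ((s + k) / m) - f ((k : ℝ) / m) =
      g ((s + k) / m) - g ((k : ℝ) / m) := fun k hk s hs0 hs1 => by
    have := congrFun (congrFun (List.ofFn_injective h) ⟨k, hk⟩) s
    simp only [dilate, ← smul_sub, clamp01_of_mem hs0 hs1] at this
    exact smul_right_injective V hm0.ne' this
  have hn : ∀ k ≤ m, f ((k : ℝ) / m) = g ((k : ℝ) / m) := fun k => by
    induction k with
    | zero => intro _; simpa using h0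
    | succ k ih =>
      intro hk
      have := hp k hk 1 zero_le_one le_rfl
      rw [ih (by omega), sub_left_inj, add_comm] at this
      exact_mod_cast this
  have hfl : (⌊(m : ℝ) * t⌋₊ : ℝ) ≤ m * t := Nat.floor_le (by positivity)
  have hlt : (m : ℝ) * t < ⌊(m : ℝ) * t⌋₊ + 1 := Nat.lt_floor_add_one _
  set k := ⌊(m : ℝ) * t⌋₊
  have hkm : k ≤ m := by
    have : (k : ℝ) ≤ m := by nlinarith
    exact_mod_cast this
  rcases hkm.eq_or_lt with e | hkm
  · have := hn m le_rfl
    rw [div_self hm0.ne'] at this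
    rw [e] at hfl
    rwa [show t = 1 by nlinarith]
  · have := hp k hkm (m * t - k) (by linarith) (by linarith)
    rwa [hn k hkm.le, sub_left_inj, sub_add_cancel, mul_div_cancel_left₀ _ hm0.ne'] at this

lemma sigmaMap_straight {m : ℕ} (hm : 1 ≤ m) (μ : V) :
    SigmaMap m (straight μ) = List.replicate m (straight μ) := by
  have hm0 : (m : ℝ) ≠ 0 := by exact_mod_cast (by omega : m ≠ 0)
  rw [SigmaMap, subdiv, ← List.ofFn_const]
  congr 1
  ext k t
  have h0 := clamp01_nonneg t
  simp only [dilate, straight]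
  rw [clamp01_of_mem (by positivity) (div_add_le_one hm k.2 (clamp01_le_one t)),
    clamp01_of_mem (by positivity) (div_le_one_of_le₀ (by exact_mod_cast k.2.le) (by positivity)),
    ← smul_sub, ← sub_smul, ← mul_smul]
  congr 1
  field_simp
  ring

lemma tensWt_sigmaMap {m : ℕ} (hm : 1 ≤ m) {f : ℝ → V} (h0 : f 0 = 0) :
    tensWt (SigmaMap m f) = (m : ℝ) • f 1 := by
  rw [SigmaMap, subdiv_eq_segments, tensWt_segments, zero_add,
    natCast_div_self (m := m) (k := 0) hm]
  simp [dilate, h0]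

lemma sigmaMap_flatMap_sigmaMap (m : ℕ) {n : ℕ} (hn : 1 ≤ n) (f : ℝ → V) :
    (SigmaMap m f).flatMap (SigmaMap n) = SigmaMap (m * n) f := by
  have hn0 : (n : ℝ) ≠ 0 := by exact_mod_cast (by omega : n ≠ 0)
  rw [SigmaMap, SigmaMap, subdiv, subdiv, List.ofFn_mul, List.flatMap_def, List.map_ofFn]
  congr 2
  ext1 k
  simp only [Function.comp_apply, SigmaMap, subdiv]
  congr 1
  ext j t
  have h0 := clamp01_nonneg t
  have hm0 : (m : ℝ) ≠ 0 := by exact_mod_cast (by have := k.2; omega : m ≠ 0)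
  simp only [dilate]
  rw [clamp01_of_mem (by positivity) (div_add_le_one hn j.2 (clamp01_le_one t)),
    clamp01_of_mem (by positivity) (div_le_one_of_le₀ (by exact_mod_cast j.2.le) (by positivity)),
    show ((clamp01 t + j) / n + k) / m = (clamp01 t + ((k * n + j : ℕ) : ℝ)) / ((m * n : ℕ) : ℝ) by
      push_cast; field_simp; ring,
    show ((j : ℝ) / n + k) / m = ((k * n + j : ℕ) : ℝ) / ((m * n : ℕ) : ℝ) by
      push_cast; field_simp; ring]
  push_cast
  module

end sigmaMap

end LSPaper

open LSPaper in
theorem statement11 {I V : Type*} [Fintype I] [DecidableEq I] [AddCommGroup V] [Module ℝ V]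
    (K : KacMoodyData I V) (μ : V) (hμ : μ ∈ K.P)
    (m : ℕ) (hm : 1 ≤ m) :
    Set.InjOn (SigmaMap m) (K.B μ) ∧
    SigmaMap m (straight μ) = List.replicate m (straight μ) ∧
    (∀ f ∈ K.B μ, tensWt (SigmaMap m f) = (m : ℝ) • f 1) ∧
    (∀ f ∈ K.B μ, ∀ i : I,
      K.tensEIter i m (SigmaMap m f) = (K.eop i f).map (SigmaMap m) ∧
      K.tensFIter i m (SigmaMap m f) = (K.fop i f).map (SigmaMap m)) ∧
    (∀ f ∈ K.B μ, ∀ i : I,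
      K.tensEps i (SigmaMap m f) = (m : ℤ) * (K.epsilon i f : ℤ) ∧
      K.tensPhi i (SigmaMap m f) = (m : ℤ) * (K.phi i f : ℤ)) ∧
    (∀ n : ℕ, 1 ≤ n → ∀ f ∈ K.B μ,
      (SigmaMap m f).flatMap (SigmaMap n) = SigmaMap (m * n) f) := by
  have hnodes : ∀ (π : K.LSData μ) (i : I), ∀ k ≤ m, IsInt (m * K.H i π.path ((k : ℝ) / m)) :=
    fun π i k hk => by
      rw [π.H_path]
      exact (π.integralSlopes hμ i).isInt_mul_apply hk
  refine ⟨?_, sigmaMap_straight hm μ, ?_, ?_, ?_, fun n hn f _ =>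
    sigmaMap_flatMap_sigmaMap m hn f⟩
  · rintro _ ⟨π, rfl⟩ _ ⟨π', rfl⟩ h
    ext t
    rw [π.path_clamp, π'.path_clamp]
    exact eq_of_sigmaMap_eq hm h (π.path_zero.trans π'.path_zero.symm) (clamp01_nonneg t)
      (clamp01_le_one t)
  · rintro _ ⟨π, rfl⟩
    exact tensWt_sigmaMap hm π.path_zero
  · rintro _ ⟨π, rfl⟩ i
    exact ⟨(π.integralPath hμ i).tensEIter_sigmaMap hm (hnodes π i),
      (π.integralPath hμ i).tensFIter_sigmaMap hm (hnodes π i)⟩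
  · rintro _ ⟨π, rfl⟩ i
    exact ⟨(π.integralPath hμ i).tensEps_sigmaMap hm (hnodes π i),
      (π.integralPath hμ i).tensPhi_sigmaMap hm (hnodes π i)⟩
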